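/- arXiv:1102.2374 — 2 statements merged into one kernel-verified Lean document; each statement's English description precedes it below -/
import Mathlib

section
/- Regular singular point existence: for the system x' = F(t,x)/t on t > 0 with F ∈ C¹(ℝ^{n+1}, ℝⁿ), there exists a solution x(t) continuous on [0,ε] for some ε > 0 with x(0) = x₀ if and only if F(0, x₀) = 0. -/
open Set
open Filter Topology MeasureTheory Polynomial
open scoped BoundedContinuousFunction NNReal

section ScalarResolvent

variable {V : Type*} [NormedAddCommGroup V] [NormedSpace ℂ V]

lemma integrableOn_cexp_neg_smul {a : ℂ} (ha : a.re < 0) (k : ℝ →ᵇ V) (τ : ℝ) :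
    IntegrableOn (fun s : ℝ => Complex.exp (-a * s) • k s) (Iic τ) := by
  have h1 := integrableOn_exp_mul_complex_Iic (a := -a) (by simpa using ha) τ
  refine (h1.norm.mul_const ‖k‖).mono' ?_ ?_
  · exact Continuous.aestronglyMeasurable (by fun_prop)
  · filter_upwards with s
    rw [norm_smul]
    gcongr
    exact k.norm_coe_le_norm s

variable [NormedSpace ℝ V]

lemma norm_cexp_smul_integral_le {a : ℂ} (ha : a.re < 0) (k : ℝ →ᵇ V) (τ : ℝ) :
    ‖Complex.exp (a * τ) • ∫ s in Iic τ, Complex.exp (-a * s) • k s‖ ≤ (-a.re)⁻¹ * ‖k‖ := by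
  have hre : 0 < -a.re := by linarith
  have h1 : ‖∫ s in Iic τ, Complex.exp (-a * s) • k s‖
      ≤ ∫ s in Iic τ, Real.exp (-a.re * s) * ‖k‖ := by
    refine norm_integral_le_of_norm_le ((integrableOn_exp_mul_Iic hre τ).mul_const _) ?_
    filter_upwards with s
    rw [norm_smul, Complex.norm_exp]
    simp only [Complex.mul_re, Complex.neg_re, Complex.ofReal_re, Complex.ofReal_im, mul_zero,
      sub_zero]
    gcongr
    exact k.norm_coe_le_norm s
  rw [norm_smul, Complex.norm_exp]
  simp only [Complex.mul_re, Complex.ofReal_re, Complex.ofReal_im, mul_zero, sub_zero]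
  rw [integral_mul_const, integral_exp_mul_Iic hre] at h1
  calc _ ≤ Real.exp (a.re * τ) * (Real.exp (-a.re * τ) / -a.re * ‖k‖) := by gcongr
    _ = (Real.exp (a.re * τ) * Real.exp (-a.re * τ)) * ((-a.re)⁻¹ * ‖k‖) := by ring
    _ = _ := by rw [← Real.exp_add]; simp

variable [IsScalarTower ℝ ℂ V]

lemma hasDerivAt_cexp_smul_integral [CompleteSpace V] {a : ℂ} (ha : a.re < 0) (k : ℝ →ᵇ V)
    (τ : ℝ) :
    HasDerivAt (fun τ : ℝ => Complex.exp (a * τ) • ∫ s in Iic τ, Complex.exp (-a * s) • k s)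
      (a • (Complex.exp (a * τ) • ∫ s in Iic τ, Complex.exp (-a * s) • k s) + k τ) τ := by
  have hc : Continuous (fun s : ℝ => Complex.exp (-a * s) • k s) := by fun_prop
  have hint : HasDerivAt (fun τ : ℝ => ∫ s in Iic τ, Complex.exp (-a * s) • k s)
      (Complex.exp (-a * τ) • k τ) τ := by
    have h := (intervalIntegral.integral_hasDerivAt_right (hc.intervalIntegrable 0 τ)
      (hc.stronglyMeasurableAtFilter _ _) hc.continuousAt).const_add
        (∫ s in Iic (0 : ℝ), Complex.exp (-a * s) • k s)
    refine h.congr_of_eventuallyEq (Eventually.of_forall fun t => ?_)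
    simp only [← intervalIntegral.integral_Iic_sub_Iic (integrableOn_cexp_neg_smul ha k 0)
      (integrableOn_cexp_neg_smul ha k t), add_sub_cancel]
  have hexp : HasDerivAt (fun τ : ℝ => Complex.exp (a * τ)) (Complex.exp (a * τ) * a) τ := by
    have := ((hasDerivAt_id τ).ofReal_comp.const_mul a).cexp
    simpa using this
  refine (hexp.smul hint).congr_deriv ?_
  rw [smul_smul (Complex.exp _) (Complex.exp _), ← Complex.exp_add, add_comm]
  simp [smul_smul, mul_comm]

lemma exists_lipschitz_scalar_solution_of_neg [CompleteSpace V] {a : ℂ} (ha : a.re < 0) :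
    ∃ (K : ℝ≥0) (L : (ℝ →ᵇ V) → (ℝ →ᵇ V)), LipschitzWith K L ∧
      ∀ k τ, HasDerivAt (L k) (a • L k τ + k τ) τ := by
  refine ⟨⟨(-a.re)⁻¹, by rw [inv_nonneg]; linarith⟩,
    fun k => BoundedContinuousFunction.ofNormedAddCommGroup
      (fun τ : ℝ => Complex.exp (a * τ) • ∫ s in Iic τ, Complex.exp (-a * s) • k s)
      (continuous_iff_continuousAt.2 fun τ => (hasDerivAt_cexp_smul_integral ha k τ).continuousAt)
      _ (norm_cexp_smul_integral_le ha k), ?_, hasDerivAt_cexp_smul_integral ha⟩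
  refine LipschitzWith.of_dist_le_mul fun k₁ k₂ => ?_
  have hpos : 0 < (-a.re)⁻¹ := by rw [inv_pos]; linarith
  refine (BoundedContinuousFunction.dist_le (by positivity)).2 fun τ => ?_
  rw [dist_eq_norm, dist_eq_norm]
  refine le_of_eq_of_le (congrArg norm ?_) (norm_cexp_smul_integral_le ha (k₁ - k₂) τ)
  have hsub : ∀ s, (k₁ - k₂) s = k₁ s - k₂ s := fun _ => rfl
  simp only [hsub, smul_sub]
  rw [integral_sub (integrableOn_cexp_neg_smul ha k₁ τ) (integrableOn_cexp_neg_smul ha k₂ τ),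
    smul_sub]
  rfl

lemma exists_lipschitz_scalar_solution [CompleteSpace V] {a : ℂ} (ha : a.re ≠ 0) :
    ∃ (K : ℝ≥0) (L : (ℝ →ᵇ V) → (ℝ →ᵇ V)), LipschitzWith K L ∧
      ∀ k τ, HasDerivAt (L k) (a • L k τ + k τ) τ := by
  rcases lt_or_gt_of_ne ha with ha | ha
  · exact exists_lipschitz_scalar_solution_of_neg ha
  obtain ⟨K, L, hL, hd⟩ := exists_lipschitz_scalar_solution_of_neg (V := V) (a := -a) (by simpa)
  let ν : C(ℝ, ℝ) := ⟨fun t => -t, continuous_neg⟩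
  have hν : LipschitzWith 1 (fun k : ℝ →ᵇ V => k.compContinuous ν) :=
    BoundedContinuousFunction.lipschitz_compContinuous ν
  refine ⟨1 * (K * 1), fun k => -(L (k.compContinuous ν)).compContinuous ν,
    (hν.comp (hL.comp hν)).neg, fun k τ => ?_⟩
  refine ((hd (k.compContinuous ν) (-τ)).scomp τ (hasDerivAt_neg τ)).neg.congr_deriv ?_
  simp [ν, add_comm]

/-- If a product of linear factors `X - a` with `a.re ≠ μ` annihilates `T` when evaluated at `A`, the
equation `y' = (A - μ) y + T k` has a bounded solution depending in a Lipschitz way on the bounded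
forcing `k`. -/
lemma exists_lipschitz_solution_of_aeval_mul_eq_zero [CompleteSpace V] (A : V →L[ℂ] V) (μ : ℝ)
    (s : Multiset ℂ) (hs : ∀ a ∈ s, a.re ≠ μ) (T : V →L[ℂ] V)
    (hT : aeval A (s.map fun a => X - C a).prod * T = 0) :
    ∃ (K : ℝ≥0) (L : (ℝ →ᵇ V) → (ℝ →ᵇ V)), LipschitzWith K L ∧
      ∀ k τ, HasDerivAt (L k) (A (L k τ) - μ • L k τ + T (k τ)) τ := by
  induction s using Multiset.induction_on generalizing T with
  | empty =>
    have hT0 : T = 0 := by simpa using hT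
    refine ⟨0, fun _ => 0, LipschitzWith.const 0, fun k τ => ?_⟩
    simp [hT0]
  | cons a s ih =>
    obtain ⟨K', L', hL', hd'⟩ := ih (fun b hb => hs b (Multiset.mem_cons_of_mem hb))
      ((A - a • 1) * T) (by
        rw [Multiset.map_cons, Multiset.prod_cons, mul_comm, map_mul, mul_assoc] at hT
        simpa only [map_sub, aeval_X, aeval_C, Algebra.algebraMap_eq_smul_one, mul_assoc] using hT)
    obtain ⟨K, R, hR, hd⟩ := exists_lipschitz_scalar_solution (V := V) (a := a - μ)
      (by simpa [sub_eq_zero] using hs a (Multiset.mem_cons_self a s))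
    refine ⟨_, fun k => T.compLeftContinuousBounded ℝ (R k) + L' (R k),
      (((T.compLeftContinuousBounded ℝ).lipschitz.comp hR).add (hL'.comp hR)), fun k τ => ?_⟩
    refine (((T.restrictScalars ℝ).hasFDerivAt.comp_hasDerivAt τ (hd k τ)).add
      (hd' (R k) τ)).congr_deriv ?_
    simp [sub_smul]
    abel

end ScalarResolvent

/-- For all but finitely many `μ`, the equation `y' = (A - μ) y + k` on `ℝⁿ` has a bounded solution
depending in a Lipschitz way on the bounded forcing `k`. -/
lemma exists_lipschitz_real_solution {n : ℕ} (A : (Fin n → ℝ) →L[ℝ] (Fin n → ℝ)) :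
    ∃ S : Finset ℝ, ∀ μ ∉ S, ∃ (K : ℝ≥0) (L : (ℝ →ᵇ (Fin n → ℝ)) → (ℝ →ᵇ (Fin n → ℝ))),
      LipschitzWith K L ∧ L 0 = 0 ∧
      ∀ k τ, HasDerivAt (L k) (A (L k τ) - μ • L k τ + k τ) τ := by
  let M := LinearMap.toMatrix' (A : (Fin n → ℝ) →ₗ[ℝ] (Fin n → ℝ))
  let B : (Fin n → ℂ) →L[ℂ] (Fin n → ℂ) :=
    LinearMap.toContinuousLinearMap (Matrix.toLin' (M.map Complex.ofReal))
  have hB : IsIntegral ℂ B := Algebra.IsIntegral.isIntegral B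
  let s := (minpoly ℂ B).roots
  have hs : aeval B (s.map fun a => X - C a).prod * 1 = 0 := by
    rw [← (IsAlgClosed.splits _).eq_prod_roots_of_monic (minpoly.monic hB), minpoly.aeval, zero_mul]
  let re : (Fin n → ℂ) →L[ℝ] (Fin n → ℝ) :=
    ContinuousLinearMap.pi fun i => Complex.reCLM.comp (ContinuousLinearMap.proj i)
  let of : (Fin n → ℝ) →L[ℝ] (Fin n → ℂ) :=
    ContinuousLinearMap.pi fun i => Complex.ofRealCLM.comp (ContinuousLinearMap.proj i)
  have hre_of : ∀ v, re (of v) = v := fun v => by ext i; simp [re, of]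
  have hre_B : ∀ v, re (B v) = A (re v) := fun v => by
    have : A (re v) = M.mulVec (re v) := by simp [M, ← Matrix.toLin'_apply]
    rw [this]
    ext i
    simp [re, B, Matrix.mulVec, dotProduct]
  refine ⟨(s.map Complex.re).toFinset, fun μ hμ => ?_⟩
  obtain ⟨K, L, hL, hd⟩ := exists_lipschitz_solution_of_aeval_mul_eq_zero B μ s
    (fun a ha h => hμ (by simpa using ⟨a, ha, h⟩)) 1 hs
  let L' := fun k => re.compLeftContinuousBounded ℝ (L (of.compLeftContinuousBounded ℝ k))
  have hL' := (re.compLeftContinuousBounded ℝ).lipschitz.comp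
    (hL.comp (of.compLeftContinuousBounded ℝ).lipschitz)
  have hd' : ∀ k τ, HasDerivAt (L' k) (A (L' k τ) - μ • L' k τ + k τ) τ := fun k τ => by
    refine (re.hasFDerivAt.comp_hasDerivAt τ
      (hd (of.compLeftContinuousBounded ℝ k) τ)).congr_deriv ?_
    simp [L', hre_B, hre_of]
  refine ⟨_, fun k => L' k - L' 0, hL'.sub (LipschitzWith.const (L' 0)), sub_self _,
    fun k τ => ((hd' k τ).sub (hd' 0 τ)).congr_deriv ?_⟩
  simp [smul_sub]
  abel

/-- A nonlinear perturbation, small and with small Lipschitz constant on the unit ball, of a linear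
equation with a Lipschitz solution operator has a solution staying in the unit ball. -/
lemma exists_bounded_solution_of_small_lipschitz {n : ℕ} {f : (Fin n → ℝ) → (Fin n → ℝ)}
    {K η : ℝ≥0} {L : (ℝ →ᵇ (Fin n → ℝ)) → (ℝ →ᵇ (Fin n → ℝ))} (hL : LipschitzWith K L)
    (hL0 : L 0 = 0) (hd : ∀ k τ, HasDerivAt (L k) (f (L k τ) + k τ) τ) (hη : K * (2 * η) ≤ 1)
    {N : ℝ → (Fin n → ℝ) → (Fin n → ℝ)} (hN : Continuous fun p : ℝ × (Fin n → ℝ) => N p.1 p.2)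
    (hN0 : ∀ τ, ‖N τ 0‖ ≤ η)
    (hNL : ∀ τ v w, ‖v‖ ≤ 1 → ‖w‖ ≤ 1 → ‖N τ v - N τ w‖ ≤ η * ‖v - w‖) :
    ∃ y : ℝ →ᵇ (Fin n → ℝ), ‖y‖ ≤ 1 ∧ ∀ τ, HasDerivAt y (f (y τ) + N τ (y τ)) τ := by
  let ρ : (Fin n → ℝ) → (Fin n → ℝ) := fun v i => max (min 1 (v i)) (-1)
  have hρc : Continuous ρ := by fun_prop
  have hρ1 : ∀ v, ‖ρ v‖ ≤ 1 := fun v => (pi_norm_le_iff_of_nonneg zero_le_one).2 fun i =>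
    abs_le.2 ⟨le_max_right _ _, max_le (min_le_left _ _) (by norm_num)⟩
  have hρid : ∀ v, ‖v‖ ≤ 1 → ρ v = v := fun v hv => by
    ext i
    have := abs_le.1 ((norm_le_pi_norm v i).trans hv)
    simp [ρ, this.1, this.2]
  have hρL : ∀ v w, ‖ρ v - ρ w‖ ≤ ‖v - w‖ := fun v w =>
    (pi_norm_le_iff_of_nonneg (norm_nonneg _)).2 fun i =>
      ((abs_max_sub_max_le_abs _ _ _).trans ((abs_min_sub_min_le_max 1 (v i) 1 (w i)).trans
        (by simp))).trans
        (norm_le_pi_norm (v - w) i)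
  have hbd : ∀ τ v, ‖N τ (ρ v)‖ ≤ 2 * η := fun τ v => by
    have h1 := hNL τ (ρ v) 0 (hρ1 v) (by simp)
    have h2 := norm_le_norm_add_norm_sub' (N τ (ρ v)) (N τ 0)
    have h3 : (η : ℝ) * ‖ρ v - 0‖ ≤ η * 1 := by rw [sub_zero]; gcongr; exact hρ1 v
    linarith [hN0 τ]
  let Φ : (ℝ →ᵇ (Fin n → ℝ)) → (ℝ →ᵇ (Fin n → ℝ)) := fun y =>
    BoundedContinuousFunction.ofNormedAddCommGroup (fun τ => N τ (ρ (y τ)))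
      (hN.comp (continuous_id.prodMk (hρc.comp y.continuous))) (2 * η) fun τ => hbd τ (y τ)
  have hΦ : LipschitzWith η Φ := LipschitzWith.of_dist_le_mul fun y z => by
    refine (BoundedContinuousFunction.dist_le (by positivity)).2 fun τ => ?_
    rw [dist_eq_norm]
    refine (hNL τ _ _ (hρ1 _) (hρ1 _)).trans ?_
    gcongr
    refine (hρL _ _).trans ?_
    rw [← dist_eq_norm]
    exact BoundedContinuousFunction.dist_coe_le_dist τ
  have hcontr : ContractingWith (K * η) (L ∘ Φ) := by
    refine ⟨lt_of_le_of_lt ?_ (one_half_lt_one : (1 / 2 : ℝ≥0) < 1), hL.comp hΦ⟩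
    rw [le_div_iff₀ two_pos]
    calc K * η * 2 = K * (2 * η) := by ring
      _ ≤ 1 := hη
  have hfix : L (Φ hcontr.fixedPoint) = hcontr.fixedPoint := hcontr.fixedPoint_isFixedPt
  set y := hcontr.fixedPoint
  have hy : ‖y‖ ≤ 1 := by
    have hΦy : ‖Φ y‖ ≤ 2 * η :=
      BoundedContinuousFunction.norm_ofNormedAddCommGroup_le _ (by positivity) _
    have h := hL.norm_le_mul hL0 (Φ y)
    rw [hfix] at h
    calc ‖y‖ ≤ K * ‖Φ y‖ := h
      _ ≤ K * (2 * η) := by gcongr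
      _ ≤ 1 := by exact_mod_cast hη
  refine ⟨y, hy, fun τ => ?_⟩
  have h := hd (Φ y) τ
  rw [hfix] at h
  convert h using 2
  change _ = N τ (ρ (y τ))
  rw [hρid _ ((y.norm_coe_le_norm τ).trans hy)]

lemma eq_zero_of_regular_singular_solution {n : ℕ} {F : ℝ × (Fin n → ℝ) → Fin n → ℝ}
    (hF : Continuous F) {ε : ℝ} (hε : 0 < ε) {x : ℝ → Fin n → ℝ} (hx : ContinuousOn x (Icc 0 ε))
    (hd : ∀ t ∈ Ioc (0 : ℝ) ε, HasDerivAt x ((1 / t) • F (t, x t)) t) : F (0, x 0) = 0 := by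
  have key : ∀ i, ∀ t ∈ Ioc (0 : ℝ) ε, ∃ ξ ∈ Ioo (t / 2) t,
      Real.log 2 * F (ξ, x ξ) i = x t i - x (t / 2) i := by
    intro i t ht
    have hsub : Icc (t / 2) t ⊆ Icc 0 ε := Icc_subset_Icc (by linarith [ht.1]) ht.2
    have hpos : ∀ s ∈ Icc (t / 2) t, 0 < s := fun s hs => by linarith [ht.1, hs.1]
    obtain ⟨ξ, hξ, h⟩ := exists_ratio_hasDerivAt_eq_ratio_slope (fun s => x s i)
      (fun s => (1 / s) * F (s, x s) i) (half_lt_self ht.1)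
      ((continuous_apply i).comp_continuousOn (hx.mono hsub))
      (fun s hs => by
        have hs' := Ioo_subset_Icc_self hs
        simpa using hasDerivAt_pi.1 (hd s ⟨hpos s hs', (hsub hs').2⟩) i)
      Real.log (fun s => s⁻¹)
      (Real.continuousOn_log.mono fun s hs => (hpos s hs).ne')
      (fun s hs => Real.hasDerivAt_log (hpos s (Ioo_subset_Icc_self hs)).ne')
    refine ⟨ξ, hξ, ?_⟩
    have hξ0 := (hpos ξ (Ioo_subset_Icc_self hξ)).ne'
    rw [Real.log_div ht.1.ne' two_ne_zero, sub_sub_cancel] at h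
    field_simp at h
    exact h
  have hmem : ∀ᶠ t in 𝓝[>] (0 : ℝ), t ∈ Ioc 0 ε := Ioc_mem_nhdsGT hε
  have hid : Tendsto (fun t : ℝ => t) (𝓝[>] 0) (𝓝 0) :=
    tendsto_nhdsWithin_of_tendsto_nhds tendsto_id
  have hhalf : Tendsto (fun t : ℝ => t / 2) (𝓝[>] 0) (𝓝 0) := by simpa using hid.div_const 2
  have hx0 : ∀ g : ℝ → ℝ, Tendsto g (𝓝[>] 0) (𝓝 0) → (∀ᶠ t in 𝓝[>] 0, g t ∈ Icc 0 ε) →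
      Tendsto (fun t => x (g t)) (𝓝[>] 0) (𝓝 (x 0)) := fun g hg hgm =>
    (hx 0 ⟨le_rfl, hε.le⟩).tendsto.comp (tendsto_nhdsWithin_iff.2 ⟨hg, hgm⟩)
  ext i
  choose! ξ hξ hξe using key i
  have hξ0 : Tendsto ξ (𝓝[>] 0) (𝓝 0) := by
    refine tendsto_of_tendsto_of_tendsto_of_le_of_le' hhalf hid ?_ ?_
    · filter_upwards [hmem] with t ht using (hξ t ht).1.le
    · filter_upwards [hmem] with t ht using (hξ t ht).2.le
  have h1 : Tendsto (fun t => Real.log 2 * F (ξ t, x (ξ t)) i) (𝓝[>] 0)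
      (𝓝 (Real.log 2 * F (0, x 0) i)) := by
    refine (tendsto_pi_nhds.1 ((hF.tendsto (0, x 0)).comp
      (hξ0.prodMk_nhds (hx0 ξ hξ0 ?_))) i).const_mul _
    filter_upwards [hmem] with t ht
    exact ⟨by linarith [ht.1, (hξ t ht).1], by linarith [ht.2, (hξ t ht).2]⟩
  have h2 : Tendsto (fun t => x t i - x (t / 2) i) (𝓝[>] 0) (𝓝 (x 0 i - x 0 i)) := by
    refine (tendsto_pi_nhds.1 (hx0 _ hid ?_) i).sub (tendsto_pi_nhds.1 (hx0 _ hhalf ?_) i)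
    · filter_upwards [hmem] with t ht using ⟨ht.1.le, ht.2⟩
    · filter_upwards [hmem] with t ht
      exact ⟨by linarith [ht.1], by linarith [ht.1, ht.2]⟩
  have h3 := tendsto_nhds_unique (h1.congr' (by filter_upwards [hmem] with t ht using hξe t ht)) h2
  rw [sub_self] at h3
  exact (mul_eq_zero.1 h3).resolve_left (Real.log_pos one_lt_two).ne'

lemma exists_regular_singular_solution {n : ℕ} {F : ℝ × (Fin n → ℝ) → Fin n → ℝ}
    (hF : ContDiff ℝ 1 F) {x₀ : Fin n → ℝ} (h0 : F (0, x₀) = 0) :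
    ∃ ε > (0 : ℝ), ∃ x : ℝ → Fin n → ℝ, ContinuousOn x (Icc 0 ε) ∧ x 0 = x₀ ∧
      ∀ t ∈ Ioc (0 : ℝ) ε, HasDerivAt x ((1 / t) • F (t, x t)) t := by
  let F' := fderiv ℝ F (0, x₀)
  have hF' : HasStrictFDerivAt F F' (0, x₀) := hF.contDiffAt.hasStrictFDerivAt one_ne_zero
  let A := F'.comp (ContinuousLinearMap.inr ℝ ℝ (Fin n → ℝ))
  obtain ⟨S, hS⟩ := exists_lipschitz_real_solution A
  obtain ⟨μ, ⟨hμ0, hμ1⟩, hμS⟩ := (Ioo_infinite (zero_lt_one (α := ℝ))).exists_notMem_finset S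
  obtain ⟨K, L, hL, hL0, hd⟩ := hS μ hμS
  let η : ℝ≥0 := (2 * (K + 1))⁻¹
  have hη0 : 0 < η := by positivity
  have hη : K * (2 * η) ≤ 1 := by
    have : K * (2 * η) = K / (K + 1) := by simp only [η]; field_simp
    rw [this]
    exact div_le_one_of_le₀ (by simp) (by simp)
  obtain ⟨δ, hδ, happ⟩ : ∃ δ > 0, ∀ p q : ℝ × (Fin n → ℝ), p ∈ Metric.ball (0, x₀) δ →
      q ∈ Metric.ball (0, x₀) δ → ‖F p - F q - F' (p - q)‖ ≤ η * ‖p - q‖ := by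
    obtain ⟨s, hs, h⟩ := hF'.approximates_deriv_on_nhds (c := η) (Or.inr hη0)
    obtain ⟨δ, hδ, hsub⟩ := Metric.mem_nhds_iff.1 hs
    exact ⟨δ, hδ, fun p q hp hq => h p (hsub hp) q (hsub hq)⟩
  have hexp : ∀ c : ℝ, 0 < c → Tendsto (fun τ => Real.exp (c * τ)) atBot (𝓝 0) := fun c hc =>
    Real.tendsto_exp_atBot.comp (tendsto_id.const_mul_atBot hc)
  obtain ⟨τ₀, hτ1, hτ2, hτ3⟩ := (((hexp 1 one_pos).eventually_lt_const hδ).and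
    (((hexp μ hμ0).eventually_lt_const hδ).and
      (((hexp (1 - μ) (by linarith)).mul_const (‖F'‖ + η)).eventually_lt_const
        (by simpa using hη0 : 0 * (‖F'‖ + η) < (η : ℝ))))).exists
  have hball : ∀ σ ≤ τ₀, ∀ v : Fin n → ℝ, ‖v‖ ≤ 1 →
      (Real.exp σ, x₀ + Real.exp (μ * σ) • v) ∈ Metric.ball ((0 : ℝ), x₀) δ := by
    intro σ hσ v hv
    rw [Metric.mem_ball, Prod.dist_eq, max_lt_iff]
    constructor
    · rw [Real.dist_0_eq_abs, Real.abs_exp]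
      exact (Real.exp_le_exp.2 (by linarith)).trans_lt hτ1
    · rw [dist_eq_norm, add_sub_cancel_left, norm_smul, Real.norm_eq_abs, Real.abs_exp]
      calc Real.exp (μ * σ) * ‖v‖ ≤ Real.exp (μ * τ₀) * 1 := by gcongr
        _ < δ := by linarith
  let G : ℝ → (Fin n → ℝ) → Fin n → ℝ := fun σ v =>
    Real.exp (-μ * σ) • F (Real.exp σ, x₀ + Real.exp (μ * σ) • v) - A v
  have hcancel : ∀ σ, Real.exp (-μ * σ) * Real.exp (μ * σ) = 1 := fun σ => by
    rw [← Real.exp_add]; simp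
  have hG0 : ∀ σ ≤ τ₀, ‖G σ 0‖ ≤ η := by
    intro σ hσ
    have h := happ (Real.exp σ, x₀) (0, x₀) (by simpa using hball σ hσ 0 (by simp))
      (Metric.mem_ball_self hδ)
    have hn : ‖((Real.exp σ, x₀) : ℝ × (Fin n → ℝ)) - (0, x₀)‖ = Real.exp σ := by
      simp [Prod.norm_def, (Real.exp_pos σ).le]
    rw [h0, sub_zero, hn] at h
    have h2 := F'.le_opNorm (((Real.exp σ, x₀) : ℝ × (Fin n → ℝ)) - (0, x₀))
    rw [hn] at h2
    have h3 := norm_le_norm_add_norm_sub' (F (Real.exp σ, x₀))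
      (F' (((Real.exp σ, x₀) : ℝ × (Fin n → ℝ)) - (0, x₀)))
    simp only [G, smul_zero, add_zero, map_zero, sub_zero, norm_smul, Real.norm_eq_abs,
      Real.abs_exp]
    calc Real.exp (-μ * σ) * ‖F (Real.exp σ, x₀)‖
        ≤ Real.exp (-μ * σ) * ((‖F'‖ + η) * Real.exp σ) := by gcongr; linarith
      _ = Real.exp ((1 - μ) * σ) * (‖F'‖ + η) := by
        rw [show (1 - μ) * σ = -μ * σ + σ by ring, Real.exp_add]; ring
      _ ≤ Real.exp ((1 - μ) * τ₀) * (‖F'‖ + η) := by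
        have : 0 ≤ 1 - μ := by linarith
        gcongr
      _ ≤ η := hτ3.le
  have hGL : ∀ σ ≤ τ₀, ∀ v w, ‖v‖ ≤ 1 → ‖w‖ ≤ 1 → ‖G σ v - G σ w‖ ≤ η * ‖v - w‖ := by
    intro σ hσ v w hv hw
    have h := happ _ _ (hball σ hσ v hv) (hball σ hσ w hw)
    have hpq : ((Real.exp σ, x₀ + Real.exp (μ * σ) • v) : ℝ × (Fin n → ℝ)) -
        (Real.exp σ, x₀ + Real.exp (μ * σ) • w) =
          Real.exp (μ * σ) • ContinuousLinearMap.inr ℝ ℝ (Fin n → ℝ) (v - w) := by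
      ext <;> simp [mul_sub]
    have hinr : ‖ContinuousLinearMap.inr ℝ ℝ (Fin n → ℝ) (v - w)‖ = ‖v - w‖ := by
      simp [Prod.norm_def]
    rw [hpq, map_smul, norm_smul, hinr, Real.norm_eq_abs, Real.abs_exp] at h
    have hG : G σ v - G σ w = Real.exp (-μ * σ) •
        (F (Real.exp σ, x₀ + Real.exp (μ * σ) • v) - F (Real.exp σ, x₀ + Real.exp (μ * σ) • w) -
          Real.exp (μ * σ) • F' (ContinuousLinearMap.inr ℝ ℝ (Fin n → ℝ) (v - w))) := by
      rw [smul_sub, smul_smul, hcancel, one_smul, smul_sub, map_sub, map_sub]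
      simp only [G, A, ContinuousLinearMap.comp_apply]
      abel
    rw [hG, norm_smul, Real.norm_eq_abs, Real.abs_exp]
    calc _ ≤ Real.exp (-μ * σ) * (η * (Real.exp (μ * σ) * ‖v - w‖)) := by gcongr
      _ = (Real.exp (-μ * σ) * Real.exp (μ * σ)) * (η * ‖v - w‖) := by ring
      _ = _ := by rw [hcancel, one_mul]
  have hFc := hF.continuous
  obtain ⟨y, hy, hyd⟩ := exists_bounded_solution_of_small_lipschitz (f := fun v => A v - μ • v)
    hL hL0 hd hη (N := fun τ v => G (min τ τ₀) v) (by fun_prop)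
    (fun τ => hG0 _ (min_le_right _ _)) (fun τ => hGL _ (min_le_right _ _))
  have hx0 : x₀ + (0 : ℝ) ^ μ • y (Real.log 0) = x₀ := by simp [Real.zero_rpow hμ0.ne']
  have hxd : ∀ t ∈ Ioc (0 : ℝ) (Real.exp τ₀), HasDerivAt (fun t => x₀ + t ^ μ • y (Real.log t))
      ((1 / t) • F (t, x₀ + t ^ μ • y (Real.log t))) t := by
    intro t ht
    have hlog : Real.log t ≤ τ₀ := (Real.log_le_iff_le_exp ht.1).2 ht.2
    have hpow : t ^ μ = Real.exp (μ * Real.log t) := by rw [Real.rpow_def_of_pos ht.1, mul_comm]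
    have h1 := (hyd (Real.log t)).scomp t (Real.hasDerivAt_log ht.1.ne')
    have h2 := ((Real.hasDerivAt_rpow_const (p := μ) (Or.inl ht.1.ne')).smul h1).const_add x₀
    refine h2.congr_deriv ?_
    simp only [min_eq_left hlog, G, Function.comp_apply, Real.exp_log ht.1]
    rw [← hpow, Real.rpow_sub_one ht.1.ne']
    have hc : t ^ μ * Real.exp (-μ * Real.log t) = 1 := by rw [hpow, mul_comm, hcancel]
    ext i
    simp only [Pi.add_apply, Pi.sub_apply, Pi.smul_apply, smul_eq_mul]
    linear_combination (t⁻¹ * F (t, x₀ + t ^ μ • y (Real.log t)) i) * hc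
  refine ⟨Real.exp τ₀, Real.exp_pos _, fun t => x₀ + t ^ μ • y (Real.log t), ?_, hx0, hxd⟩
  intro t ht
  rcases ht.1.eq_or_lt with rfl | hpos
  · have hlim : Tendsto (fun t : ℝ => t ^ μ • y (Real.log t)) (𝓝 0) (𝓝 0) := by
      have hp : Tendsto (fun t : ℝ => t ^ μ) (𝓝 0) (𝓝 0) := by
        simpa [Real.zero_rpow hμ0.ne'] using
          (Real.continuousAt_rpow_const 0 μ (Or.inr hμ0.le)).tendsto
      exact hp.zero_smul_isBoundedUnder_le (isBoundedUnder_of ⟨‖y‖, fun t => y.norm_coe_le_norm _⟩)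
    refine ContinuousAt.continuousWithinAt ?_
    rw [ContinuousAt, hx0]
    simpa using hlim.const_add x₀
  · exact (hxd t ⟨hpos, ht.2⟩).continuousAt.continuousWithinAt

/-- Regular singular point existence: the system `x' = F(t,x)/t`, `t > 0`, with
`F ∈ C¹`, has a solution continuous on `[0,ε]` with `x(0) = x₀` if and only if
`F(0,x₀) = 0`. -/
theorem stmt16 (n : ℕ) (F : ℝ × (Fin n → ℝ) → Fin n → ℝ)
    (hF : ContDiff ℝ 1 F) (x₀ : Fin n → ℝ) :
    (∃ ε > (0:ℝ), ∃ x : ℝ → Fin n → ℝ,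
      ContinuousOn x (Set.Icc 0 ε) ∧ x 0 = x₀ ∧
      ∀ t ∈ Set.Ioc (0:ℝ) ε, HasDerivAt x ((1/t) • F (t, x t)) t) ↔
    F (0, x₀) = 0 := by
  refine ⟨?_, exists_regular_singular_solution hF⟩
  rintro ⟨ε, hε, x, hx, rfl, hd⟩
  exact eq_zero_of_regular_singular_solution hF.continuous hε hx hd
end

section
/- Uniqueness at a regular singular point: let F ∈ C²(ℝ^{n+1}, ℝⁿ) with F(0,x₀) = 0, and suppose F_x(0,x₀) has no eigenvalue with positive real part (E₊ = {0}). Then there is a unique solution x(t) of x' = F(t,x)/t on (0,ε] that is Hölder continuous on [0,ε] with x(0) = x₀. If moreover F_t(0,x₀) = 0, then x(t) - x₀ = O(t²) as t → 0. -/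
open Set Filter Topology Asymptotics

theorem Matrix.exp_mulVec_of_mulVec_eq_smul {n : ℕ} (A : Matrix (Fin n) (Fin n) ℂ)
    {v : Fin n → ℂ} {l : ℂ} (h : A.mulVec v = l • v) :
    (NormedSpace.exp A).mulVec v = Complex.exp l • v := by
  let : NormedRing (Matrix (Fin n) (Fin n) ℂ) := Matrix.linftyOpNormedRing
  let : NormedAlgebra ℂ (Matrix (Fin n) (Fin n) ℂ) := Matrix.linftyOpNormedAlgebra
  have hpow : ∀ k : ℕ, (A ^ k).mulVec v = l ^ k • v := by
    intro k
    induction k with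
    | zero => simp
    | succ k ih => rw [pow_succ', ← Matrix.mulVec_mulVec, ih, Matrix.mulVec_smul, h, smul_smul,
        pow_succ]
  have h1 := NormedSpace.exp_series_hasSum_exp' (𝕂 := ℂ) A
  let T : Matrix (Fin n) (Fin n) ℂ →ₗ[ℂ] (Fin n → ℂ) :=
    { toFun := fun M => M.mulVec v
      map_add' := fun M N => Matrix.add_mulVec M N v
      map_smul' := fun c M => Matrix.smul_mulVec c M v }
  have h2 := h1.mapL (LinearMap.toContinuousLinearMap T)
  have h3 := (NormedSpace.exp_series_hasSum_exp' (𝕂 := ℂ) l).smul_const v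
  rw [← Complex.exp_eq_exp_ℂ] at h3
  have h4 : ∀ k : ℕ, ((k.factorial : ℂ)⁻¹ • A ^ k).mulVec v = ((k.factorial : ℂ)⁻¹ • l ^ k) • v := by
    intro k
    rw [Matrix.smul_mulVec, hpow, smul_smul, smul_eq_mul]
  simp_rw [← h4] at h3
  exact h2.unique h3

theorem Matrix.exists_mem_spectrum_of_mem_spectrum_exp {n : ℕ} (A : Matrix (Fin n) (Fin n) ℂ)
    {μ : ℂ} (hμ : μ ∈ spectrum ℂ (NormedSpace.exp A)) :
    ∃ l ∈ spectrum ℂ A, μ = Complex.exp l := by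
  let : NormedRing (Matrix (Fin n) (Fin n) ℂ) := Matrix.linftyOpNormedRing
  let : NormedAlgebra ℂ (Matrix (Fin n) (Fin n) ℂ) := Matrix.linftyOpNormedAlgebra
  let : NormedAlgebra ℚ (Matrix (Fin n) (Fin n) ℂ) := NormedAlgebra.restrictScalars ℚ ℂ _
  set f := Matrix.toLin' A
  set g := Matrix.toLin' (NormedSpace.exp A)
  have hcomm : Commute f g := by
    change f * g = g * f
    rw [Module.End.mul_eq_comp, Module.End.mul_eq_comp, ← Matrix.toLin'_mul,
      ← Matrix.toLin'_mul, ((Commute.refl A).exp_right).eq]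
  rw [← Matrix.spectrum_toLin', ← Module.End.hasEigenvalue_iff_mem_spectrum] at hμ
  have hmaps : ∀ v ∈ Module.End.eigenspace g μ, f v ∈ Module.End.eigenspace g μ := by
    intro v hv
    rw [Module.End.mem_eigenspace_iff] at hv ⊢
    have := congrArg (fun T => T v) hcomm.eq
    simp only [Module.End.mul_apply] at this
    rw [← this, hv, map_smul]
  have : Nontrivial (Module.End.eigenspace g μ) :=
    (Submodule.nontrivial_iff_ne_bot).2 hμ
  obtain ⟨l, hl⟩ := Module.End.exists_eigenvalue (f.restrict hmaps)
  obtain ⟨v, hv, hv0⟩ := hl.exists_hasEigenvector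
  rw [Module.End.mem_eigenspace_iff] at hv
  have hv1 : f v = l • (v : Fin n → ℂ) := congrArg Subtype.val hv
  have hv2 : (v : Fin n → ℂ) ≠ 0 := fun h => hv0 (Subtype.ext h)
  refine ⟨l, ?_, ?_⟩
  · rw [← Matrix.spectrum_toLin', ← Module.End.hasEigenvalue_iff_mem_spectrum]
    exact Module.End.hasEigenvalue_of_hasEigenvector
      ⟨Module.End.mem_eigenspace_iff.2 hv1, hv2⟩
  · have h1 := Matrix.exp_mulVec_of_mulVec_eq_smul A (v := v) (l := l) hv1
    have h2 : (NormedSpace.exp A).mulVec v = μ • (v : Fin n → ℂ) :=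
      Module.End.mem_eigenspace_iff.1 v.2
    rw [h2] at h1
    exact smul_left_injective ℂ hv2 h1

theorem exists_norm_pow_le_exp_mul {A : Type*} [NormedRing A] [NormedAlgebra ℂ A]
    [CompleteSpace A] (b : A) (hb : ∀ z ∈ spectrum ℂ b, ‖z‖ ≤ 1) {δ : ℝ} (hδ : 0 < δ) :
    ∃ C > 0, ∀ k : ℕ, ‖b ^ k‖ ≤ C * Real.exp (δ * k) := by
  have hr : spectralRadius ℂ b ≤ 1 := by
    refine iSup₂_le fun z hz => ?_
    exact_mod_cast hb z hz
  have hlt : spectralRadius ℂ b < ENNReal.ofReal (Real.exp δ) := by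
    refine hr.trans_lt ?_
    rw [← ENNReal.ofReal_one]
    exact (ENNReal.ofReal_lt_ofReal_iff (Real.exp_pos _)).2 (by simpa using hδ)
  have hev := (spectrum.pow_norm_pow_one_div_tendsto_nhds_spectralRadius b).eventually_lt_const hlt
  obtain ⟨N, hN⟩ := (hev.and (eventually_ge_atTop 1)).exists_forall_of_atTop
  refine ⟨1 + ∑ k ∈ Finset.range N, ‖b ^ k‖, by positivity, fun k => ?_⟩
  have hS : 0 ≤ ∑ k ∈ Finset.range N, ‖b ^ k‖ := by positivity
  have h1 : 1 ≤ Real.exp (δ * k) := Real.one_le_exp (by positivity)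
  by_cases hk : k < N
  · have := Finset.single_le_sum (f := fun k => ‖b ^ k‖) (fun i _ => norm_nonneg _)
      (Finset.mem_range.2 hk)
    nlinarith
  · obtain ⟨h2, h3⟩ := hN k (not_lt.1 hk)
    have h4 : ‖b ^ k‖ ^ (1 / (k : ℝ)) < Real.exp δ :=
      (ENNReal.ofReal_lt_ofReal_iff (Real.exp_pos _)).1 h2
    have hk0 : (k : ℝ) ≠ 0 := by positivity
    have h5 : ‖b ^ k‖ ≤ Real.exp (δ * k) := by
      calc ‖b ^ k‖ = (‖b ^ k‖ ^ (1 / (k : ℝ))) ^ (k : ℝ) := by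
            rw [← Real.rpow_mul (norm_nonneg _), one_div_mul_cancel hk0, Real.rpow_one]
        _ ≤ (Real.exp δ) ^ (k : ℝ) := by gcongr
        _ = Real.exp (δ * k) := by rw [← Real.exp_mul]
    nlinarith

theorem exists_norm_exp_smul_le {A : Type*} [NormedRing A] [NormedAlgebra ℂ A]
    [CompleteSpace A] (a : A) (ha : ∀ z ∈ spectrum ℂ (NormedSpace.exp a), ‖z‖ ≤ 1)
    {δ : ℝ} (hδ : 0 < δ) :
    ∃ C > 0, ∀ τ : ℝ, 0 ≤ τ → ‖NormedSpace.exp ((τ : ℂ) • a)‖ ≤ C * Real.exp (δ * τ) := by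
  let : NormedAlgebra ℚ A := NormedAlgebra.restrictScalars ℚ ℂ A
  obtain ⟨C, hC, hpow⟩ := exists_norm_pow_le_exp_mul _ ha hδ
  have hcont : Continuous fun τ : ℝ => NormedSpace.exp ((τ : ℂ) • a) :=
    NormedSpace.exp_continuous.comp (Complex.continuous_ofReal.smul continuous_const)
  obtain ⟨D, hD⟩ := isCompact_Icc.exists_bound_of_continuousOn (s := Icc (0 : ℝ) 1)
    hcont.continuousOn
  have hD0 : 0 ≤ D := (norm_nonneg _).trans (hD 0 (by simp))
  refine ⟨C * (D + 1), by positivity, fun τ hτ => ?_⟩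
  set k := ⌊τ⌋₊
  have hk1 : (k : ℝ) ≤ τ := Nat.floor_le hτ
  have hk2 : τ < k + 1 := Nat.lt_floor_add_one τ
  have hsplit : NormedSpace.exp ((τ : ℂ) • a)
      = NormedSpace.exp a ^ k * NormedSpace.exp (((τ - k : ℝ) : ℂ) • a) := by
    rw [← NormedSpace.exp_nsmul, ← NormedSpace.exp_add_of_commute]
    · congr 1
      rw [← Nat.cast_smul_eq_nsmul ℂ, ← add_smul]
      push_cast
      congr 1
      ring
    · exact ((Commute.refl a).smul_right _).smul_left _
  rw [hsplit]
  calc _ ≤ ‖NormedSpace.exp a ^ k‖ * ‖NormedSpace.exp (((τ - k : ℝ) : ℂ) • a)‖ := norm_mul_le _ _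
    _ ≤ (C * Real.exp (δ * k)) * (D + 1) := by
        gcongr
        · exact hpow k
        · exact (hD _ ⟨by linarith, by linarith⟩).trans (by linarith)
    _ = C * (D + 1) * Real.exp (δ * k) := by ring
    _ ≤ _ := by gcongr

theorem Matrix.exists_norm_exp_smul_toLin'_le {n : ℕ} (J : Matrix (Fin n) (Fin n) ℝ)
    (hspec : ∀ z ∈ spectrum ℂ (J.map (fun r => (r : ℂ))), z.re ≤ 0) {δ : ℝ} (hδ : 0 < δ) :
    ∃ C > 0, ∀ τ : ℝ, 0 ≤ τ →
      ‖NormedSpace.exp (τ • LinearMap.toContinuousLinearMap (Matrix.toLin' J))‖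
        ≤ C * Real.exp (δ * τ) := by
  let : NormedRing (Matrix (Fin n) (Fin n) ℂ) := Matrix.linftyOpNormedRing
  let : NormedAlgebra ℂ (Matrix (Fin n) (Fin n) ℂ) := Matrix.linftyOpNormedAlgebra
  let : NormedRing (Matrix (Fin n) (Fin n) ℝ) := Matrix.linftyOpNormedRing
  let : NormedAlgebra ℝ (Matrix (Fin n) (Fin n) ℝ) := Matrix.linftyOpNormedAlgebra
  let : NormedAlgebra ℚ (Matrix (Fin n) (Fin n) ℝ) := NormedAlgebra.restrictScalars ℚ ℝ _
  let : NormedAlgebra ℚ ((Fin n → ℝ) →L[ℝ] (Fin n → ℝ)) := NormedAlgebra.restrictScalars ℚ ℝ _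
  have hexp : ∀ z ∈ spectrum ℂ (NormedSpace.exp (J.map (fun r => (r : ℂ)))), ‖z‖ ≤ 1 := by
    intro z hz
    obtain ⟨l, hl, rfl⟩ := Matrix.exists_mem_spectrum_of_mem_spectrum_exp _ hz
    rw [Complex.norm_exp]
    exact Real.exp_le_one_iff.2 (hspec l hl)
  obtain ⟨C, hC, hbound⟩ := exists_norm_exp_smul_le _ hexp hδ
  refine ⟨C, hC, fun τ hτ => ?_⟩
  have hnorm : ∀ M : Matrix (Fin n) (Fin n) ℝ, ‖M.map (fun r => (r : ℂ))‖ = ‖M‖ := by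
    intro M
    simp [Matrix.linfty_opNorm_def]
  have hmap : (NormedSpace.exp (τ • J)).map (fun r => (r : ℂ))
      = NormedSpace.exp ((τ : ℂ) • J.map (fun r => (r : ℂ))) := by
    have h := NormedSpace.map_exp (Complex.ofRealHom.mapMatrix (m := Fin n))
      (by
        change Continuous fun M : Matrix (Fin n) (Fin n) ℝ => M.map (fun r => (r : ℂ))
        exact Continuous.matrix_map continuous_id Complex.continuous_ofReal) (τ • J)
    refine h.trans ?_
    congr 1
    ext i j
    simp
  let Φ := (Matrix.toLinAlgEquiv' (R := ℝ) (n := Fin n)).trans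
    (Module.End.toContinuousLinearMap (𝕜 := ℝ) (Fin n → ℝ))
  have hΦ : NormedSpace.exp (τ • LinearMap.toContinuousLinearMap (Matrix.toLin' J))
      = Φ (NormedSpace.exp (τ • J)) := by
    refine Eq.trans ?_ (NormedSpace.map_exp Φ
      (LinearMap.continuous_of_finiteDimensional Φ.toLinearMap) (τ • J)).symm
    rw [map_smul]
    rfl
  rw [hΦ]
  refine ContinuousLinearMap.opNorm_le_bound _ (by positivity) fun v => ?_
  change ‖(NormedSpace.exp (τ • J)).mulVec v‖ ≤ _
  refine (Matrix.linfty_opNorm_mulVec _ v).trans ?_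
  gcongr
  rw [← hnorm, hmap]
  exact hbound τ hτ

section LinearPerturbation

variable {E : Type*} [NormedAddCommGroup E] [NormedSpace ℝ E] [CompleteSpace E]

theorem ContinuousLinearMap.exp_add_smul (B : E →L[ℝ] E) (s t : ℝ) :
    NormedSpace.exp ((s + t) • B) = NormedSpace.exp (s • B) * NormedSpace.exp (t • B) := by
  let _ : NormedAlgebra ℚ (E →L[ℝ] E) := NormedAlgebra.restrictScalars ℚ ℝ _
  rw [add_smul, NormedSpace.exp_add_of_commute]
  exact ((Commute.refl B).smul_right _).smul_left _

theorem norm_le_of_hasDerivAt_of_norm_exp_smul_le {B : E →L[ℝ] E} {C c : ℝ} (hC : 0 < C)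
    (hc : 0 < c) (hB : ∀ τ : ℝ, 0 ≤ τ → ‖NormedSpace.exp (τ • B)‖ ≤ C * Real.exp (-c * τ))
    {d h : ℝ → E} {s M H b : ℝ} (hb : 0 ≤ b) (hH : 0 ≤ H)
    (hd : ∀ σ ≤ s, HasDerivAt d (B (d σ) + h σ) σ) (hM : ∀ σ ≤ s, ‖d σ‖ ≤ M)
    (hh : ∀ σ ≤ s, ‖h σ‖ ≤ H * Real.exp (b * σ)) :
    ‖d s‖ ≤ C * H / c * Real.exp (b * s) := by
  set K := H * Real.exp (b * s) with hK
  have hK0 : 0 ≤ K := by positivity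
  have key : ∀ r ≤ s, ‖d s‖ ≤ C * Real.exp (-c * (s - r)) * M + C * K / c := by
    intro r hr
    set f : ℝ → E := fun σ => NormedSpace.exp ((s - σ) • B) (d σ) with hf
    set β : ℝ → ℝ := fun σ => C * Real.exp (-c * (s - r)) * M + C * K / c * Real.exp (-c * (s - σ))
    have hder : ∀ σ ≤ s, HasDerivAt f (NormedSpace.exp ((s - σ) • B) (h σ)) σ := by
      intro σ hσ
      have h1 : HasDerivAt (fun σ : ℝ => NormedSpace.exp ((s - σ) • B))
          ((-1 : ℝ) • (NormedSpace.exp ((s - σ) • B) * B)) σ :=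
        (hasDerivAt_exp_smul_const B (s - σ)).scomp σ ((hasDerivAt_id σ).const_sub s)
      refine (h1.clm_apply (hd σ hσ)).congr_deriv ?_
      simp
    have hβ : ∀ σ, HasDerivAt β (C * K * Real.exp (-c * (s - σ))) σ := by
      intro σ
      have h1 : HasDerivAt (fun σ : ℝ => -c * (s - σ)) c σ := by
        simpa using ((hasDerivAt_id σ).const_sub s).const_mul (-c)
      refine ((h1.exp.const_mul (C * K / c)).const_add
        (C * Real.exp (-c * (s - r)) * M)).congr_deriv ?_
      field_simp
    have h0 : ‖f r‖ ≤ β r := by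
      have : ‖f r‖ ≤ C * Real.exp (-c * (s - r)) * M := by
        refine (ContinuousLinearMap.le_opNorm _ _).trans ?_
        gcongr
        · exact hB _ (by linarith)
        · exact hM r hr
      have h2 : 0 ≤ C * K / c * Real.exp (-c * (s - r)) := by positivity
      simp only [β]
      linarith
    have := image_norm_le_of_norm_deriv_right_le_deriv_boundary (f := f) (a := r) (b := s)
      (fun σ hσ => (hder σ hσ.2).continuousAt.continuousWithinAt)
      (fun σ hσ => (hder σ hσ.2.le).hasDerivWithinAt) h0 hβ (fun σ hσ => by
        refine (ContinuousLinearMap.le_opNorm _ _).trans ?_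
        calc _ ≤ (C * Real.exp (-c * (s - σ))) * K := by
              gcongr
              · exact hB _ (by linarith [hσ.2])
              · refine (hh σ hσ.2.le).trans ?_
                rw [hK]
                gcongr
                exact hσ.2.le
          _ = _ := by ring) (right_mem_Icc.2 hr)
    simpa [f, β] using this
  have hlim : Tendsto (fun r : ℝ => C * Real.exp (-c * (s - r)) * M + C * K / c) atBot
      (𝓝 (C * 0 * M + C * K / c)) := by
    refine Tendsto.add_const _ (Tendsto.mul_const _ (Tendsto.const_mul _ ?_))
    refine Real.tendsto_exp_atBot.comp ?_
    have h1 : Tendsto (fun r : ℝ => c * r) atBot atBot := tendsto_id.const_mul_atBot hc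
    refine (tendsto_atBot_add_const_right _ (-c * s) h1).congr fun r => ?_
    ring
  have := ge_of_tendsto hlim ((eventually_le_atBot s).mono key)
  calc _ ≤ _ := this
    _ = _ := by rw [hK]; ring

theorem exists_hasDerivAt_bounded_of_norm_exp_smul_le {B : E →L[ℝ] E} {C c : ℝ} (hC : 0 < C)
    (hc : 0 < c) (hB : ∀ τ : ℝ, 0 ≤ τ → ‖NormedSpace.exp (τ • B)‖ ≤ C * Real.exp (-c * τ))
    {h : ℝ → E} (hcont : Continuous h) {H : ℝ} (hH : ∀ s, ‖h s‖ ≤ H) :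
    ∃ z : ℝ → E, ∀ s, HasDerivAt z (B (z s) + h s) s ∧ ‖z s‖ ≤ C * H / c := by
  let _ : NormedAlgebra ℚ (E →L[ℝ] E) := NormedAlgebra.restrictScalars ℚ ℝ _
  have hH0 : 0 ≤ H := (norm_nonneg _).trans (hH 0)
  have hexpc : Continuous fun σ : ℝ => NormedSpace.exp ((-σ) • B) :=
    NormedSpace.exp_continuous.comp (by fun_prop)
  set φ : ℝ → E := fun σ => NormedSpace.exp ((-σ) • B) (h σ) with hφ
  have hφc : Continuous φ := hexpc.clm_apply hcont
  have hsplit : ∀ s σ : ℝ,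
      NormedSpace.exp ((s - σ) • B) (h σ) = NormedSpace.exp (s • B) (φ σ) := by
    intro s σ
    rw [sub_eq_add_neg, B.exp_add_smul]
    rfl
  have hinv : ∀ s : ℝ, ∀ v, NormedSpace.exp (s • B) (NormedSpace.exp ((-s) • B) v) = v := by
    intro s v
    rw [← mul_apply_eq_comp, ← B.exp_add_smul]
    simp
  have hinv' : ∀ s : ℝ, ∀ v, NormedSpace.exp ((-s) • B) (NormedSpace.exp (s • B) v) = v := by
    intro s v
    simpa using hinv (-s) v
  have hdom : ∀ s, ∀ σ ∈ Iic s, ‖NormedSpace.exp (s • B) (φ σ)‖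
      ≤ C * H * Real.exp (-c * s) * Real.exp (c * σ) := by
    intro s σ hσ
    rw [← hsplit]
    refine (ContinuousLinearMap.le_opNorm _ _).trans ?_
    calc _ ≤ (C * Real.exp (-c * (s - σ))) * H := by
          gcongr
          · exact hB _ (by simpa using hσ)
          · exact hH σ
      _ = _ := by
          rw [mul_assoc (C * H), ← Real.exp_add, mul_right_comm]
          congr 2
          ring
  have hdomint : ∀ s, MeasureTheory.IntegrableOn
      (fun σ => C * H * Real.exp (-c * s) * Real.exp (c * σ)) (Iic s) :=
    fun s => (integrableOn_exp_mul_Iic hc s).const_mul _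
  have hφint' : ∀ s, MeasureTheory.IntegrableOn (fun σ => NormedSpace.exp (s • B) (φ σ)) (Iic s) := by
    intro s
    refine (hdomint s).mono' (by fun_prop) ?_
    exact (MeasureTheory.ae_restrict_iff' measurableSet_Iic).2 (MeasureTheory.ae_of_all _ (hdom s))
  have hφint : ∀ s, MeasureTheory.IntegrableOn φ (Iic s) := by
    intro s
    have := (NormedSpace.exp ((-s) • B)).integrable_comp (hφint' s)
    simp only [hinv'] at this
    exact this
  refine ⟨fun s => NormedSpace.exp (s • B) (∫ σ in Iic s, φ σ), fun s => ⟨?_, ?_⟩⟩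
  · have h1 : HasDerivAt (fun s => ∫ σ in Iic s, φ σ) (φ s) s := by
      have h2 : (fun s => ∫ σ in Iic s, φ σ)
          = fun s => (∫ σ in Iic (0 : ℝ), φ σ) + ∫ σ in (0 : ℝ)..s, φ σ := by
        funext s
        rw [← intervalIntegral.integral_Iic_sub_Iic (hφint 0) (hφint s)]
        abel
      rw [h2]
      exact (hφc.integral_hasStrictDerivAt 0 s).hasDerivAt.const_add _
    convert (hasDerivAt_exp_smul_const' B s).clm_apply h1 using 1
    rw [hφ, hinv]
    rfl
  · beta_reduce
    rw [← ContinuousLinearMap.integral_comp_comm _ (hφint s)]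
    refine (MeasureTheory.norm_integral_le_of_norm_le (hdomint s)
      ((MeasureTheory.ae_restrict_iff' measurableSet_Iic).2 (MeasureTheory.ae_of_all _ (hdom s)))).trans ?_
    rw [MeasureTheory.integral_const_mul, integral_exp_mul_Iic hc]
    apply le_of_eq
    have : Real.exp (-c * s) * Real.exp (c * s) = 1 := by
      rw [← Real.exp_add]; simp
    calc _ = C * H / c * (Real.exp (-c * s) * Real.exp (c * s)) := by ring
      _ = _ := by rw [this, mul_one]

theorem exists_hasDerivAt_bounded_of_lipschitz {B : E →L[ℝ] E} {C c : ℝ} (hC : 0 < C)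
    (hc : 0 < c) (hB : ∀ τ : ℝ, 0 ≤ τ → ‖NormedSpace.exp (τ • B)‖ ≤ C * Real.exp (-c * τ))
    {g : ℝ → E → E} (hcont : Continuous fun p : ℝ × E => g p.1 p.2) {H L : ℝ} (hL0 : 0 ≤ L)
    (hH : ∀ s z, ‖g s z‖ ≤ H) (hL : ∀ s z w, ‖g s z - g s w‖ ≤ L * ‖z - w‖)
    (hCL : C * L / c ≤ 1 / 2) :
    ∃ z : ℝ → E, ∀ s, HasDerivAt z (B (z s) + g s (z s)) s ∧ ‖z s‖ ≤ C * H / c := by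
  have hS : ∀ z : BoundedContinuousFunction ℝ E, ∃ w : BoundedContinuousFunction ℝ E,
      ∀ s, HasDerivAt w (B (w s) + g s (z s)) s ∧ ‖w s‖ ≤ C * H / c := by
    intro z
    obtain ⟨w, hw⟩ := exists_hasDerivAt_bounded_of_norm_exp_smul_le hC hc hB
      (h := fun s => g s (z s)) (hcont.comp (continuous_id.prodMk z.continuous))
      (fun s => hH s (z s))
    exact ⟨BoundedContinuousFunction.ofNormedAddCommGroup w
      (continuous_iff_continuousAt.2 fun s => (hw s).1.continuousAt) _ fun s => (hw s).2, hw⟩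
  choose T hT using hS
  have hcontr : ContractingWith (1 / 2) T := by
    refine ⟨by norm_num, LipschitzWith.of_dist_le_mul fun z w => ?_⟩
    refine (BoundedContinuousFunction.dist_le (by positivity)).2 fun s => ?_
    have := norm_le_of_hasDerivAt_of_norm_exp_smul_le hC hc hB (d := fun s => T z s - T w s)
      (h := fun s => g s (z s) - g s (w s)) (s := s) (M := C * H / c + C * H / c)
      (H := L * dist z w) (b := 0) le_rfl (by positivity)
      (fun σ _ => by
        refine ((hT z σ).1.sub (hT w σ).1).congr_deriv ?_
        rw [map_sub]
        abel)
      (fun σ _ => (norm_sub_le _ _).trans (add_le_add (hT z σ).2 (hT w σ).2))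
      (fun σ _ => by
        refine (hL σ _ _).trans ?_
        rw [zero_mul, Real.exp_zero, mul_one, ← dist_eq_norm]
        gcongr
        exact BoundedContinuousFunction.dist_coe_le_dist σ)
    rw [zero_mul, Real.exp_zero, mul_one] at this
    rw [dist_eq_norm]
    refine this.trans ?_
    calc C * (L * dist z w) / c = C * L / c * dist z w := by ring
      _ ≤ 1 / 2 * dist z w := by gcongr
      _ = _ := by simp
  set z := hcontr.fixedPoint T
  have hz : T z = z := hcontr.fixedPoint_isFixedPt
  refine ⟨z, fun s => ?_⟩
  have := hT z s
  rwa [hz] at this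

theorem eq_zero_of_hasDerivAt_of_norm_exp_smul_le {B : E →L[ℝ] E} {C c : ℝ} (hC : 0 < C)
    (hc : 0 < c) (hB : ∀ τ : ℝ, 0 ≤ τ → ‖NormedSpace.exp (τ • B)‖ ≤ C * Real.exp (-c * τ))
    {d h : ℝ → E} {s₁ M L : ℝ} (hL0 : 0 ≤ L) (hCL : C * L / c ≤ 1 / 2)
    (hd : ∀ σ ≤ s₁, HasDerivAt d (B (d σ) + h σ) σ) (hM : ∀ σ ≤ s₁, ‖d σ‖ ≤ M)
    (hh : ∀ σ ≤ s₁, ‖h σ‖ ≤ L * ‖d σ‖) :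
    ∀ s ≤ s₁, d s = 0 := by
  have hM0 : 0 ≤ M := (norm_nonneg _).trans (hM s₁ le_rfl)
  have hiter : ∀ k : ℕ, ∀ s ≤ s₁, ‖d s‖ ≤ (1 / 2) ^ k * M := by
    intro k
    induction k with
    | zero => simpa using hM
    | succ k ih =>
      intro s hs
      have := norm_le_of_hasDerivAt_of_norm_exp_smul_le hC hc hB (d := d) (h := h) (s := s)
        (M := M) (H := L * ((1 / 2) ^ k * M)) (b := 0) le_rfl (by positivity)
        (fun σ hσ => hd σ (hσ.trans hs)) (fun σ hσ => hM σ (hσ.trans hs))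
        (fun σ hσ => by
          refine (hh σ (hσ.trans hs)).trans ?_
          rw [zero_mul, Real.exp_zero, mul_one]
          gcongr
          exact ih σ (hσ.trans hs))
      rw [zero_mul, Real.exp_zero, mul_one] at this
      refine this.trans ?_
      calc C * (L * ((1 / 2) ^ k * M)) / c = C * L / c * ((1 / 2) ^ k * M) := by ring
        _ ≤ 1 / 2 * ((1 / 2) ^ k * M) := by gcongr
        _ = _ := by ring
  intro s hs
  have hlim : Tendsto (fun k : ℕ => (1 / 2 : ℝ) ^ k * M) atTop (𝓝 (0 * M)) :=
    (tendsto_pow_atTop_nhds_zero_of_lt_one (by norm_num) (by norm_num)).mul_const M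
  have := ge_of_tendsto' hlim fun k => hiter k s hs
  simpa using this

end LinearPerturbation

section RegularSingular

variable {E : Type*} [NormedAddCommGroup E] [NormedSpace ℝ E]

theorem norm_exp_smul_sub_smul_one_le [CompleteSpace E] {J : E →L[ℝ] E} {C δ : ℝ}
    (hJ : ∀ τ : ℝ, 0 ≤ τ → ‖NormedSpace.exp (τ • J)‖ ≤ C * Real.exp (δ * τ)) (γ τ : ℝ)
    (hτ : 0 ≤ τ) :
    ‖NormedSpace.exp (τ • (J - γ • (1 : E →L[ℝ] E)))‖ ≤ C * Real.exp (-(γ - δ) * τ) := by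
  let _ : NormedAlgebra ℚ (E →L[ℝ] E) := NormedAlgebra.restrictScalars ℚ ℝ _
  have h1 : NormedSpace.exp (τ • (J - γ • (1 : E →L[ℝ] E)))
      = Real.exp (-γ * τ) • NormedSpace.exp (τ • J) := by
    have h2 : τ • (J - γ • (1 : E →L[ℝ] E)) = τ • J + algebraMap ℝ (E →L[ℝ] E) (-γ * τ) := by
      rw [Algebra.algebraMap_eq_smul_one]
      module
    rw [h2, NormedSpace.exp_add_of_commute (Algebra.commutes _ _).symm,
      ← NormedSpace.algebraMap_exp_comm, ← Real.exp_eq_exp_ℝ, ← Algebra.commutes,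
      ← Algebra.smul_def]
  rw [h1, norm_smul, Real.norm_eq_abs, Real.abs_exp]
  calc _ ≤ Real.exp (-γ * τ) * (C * Real.exp (δ * τ)) := by
        gcongr
        exact hJ τ hτ
    _ = C * (Real.exp (-γ * τ) * Real.exp (δ * τ)) := by ring
    _ = _ := by
        rw [← Real.exp_add]
        congr 2
        ring

theorem HasStrictFDerivAt.exists_norm_sub_sub_le {X : Type*} [NormedAddCommGroup X]
    [NormedSpace ℝ X] {F : X → E} {D : X →L[ℝ] E} {p₀ : X} (h : HasStrictFDerivAt F D p₀)
    {L : ℝ} (hL : 0 < L) :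
    ∃ r > 0, ∀ p q, ‖p - p₀‖ < r → ‖q - p₀‖ < r → ‖F p - F q - D (p - q)‖ ≤ L * ‖p - q‖ := by
  obtain ⟨s, hs, hs'⟩ := h.approximates_deriv_on_nhds (c := ⟨L, hL.le⟩) (Or.inr hL)
  obtain ⟨r, hr, hrs⟩ := Metric.mem_nhds_iff.1 hs
  exact ⟨r, hr, fun p q hp hq =>
    hs' p (hrs (by simpa [dist_eq_norm] using hp)) q (hrs (by simpa [dist_eq_norm] using hq))⟩

theorem ContDiff.exists_norm_sub_sub_fderiv_le_sq {X : Type*} [NormedAddCommGroup X]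
    [NormedSpace ℝ X] {F : X → E} (hF : ContDiff ℝ 2 F) (p₀ : X) :
    ∃ K ≥ 0, ∃ r > 0, ∀ p, ‖p - p₀‖ < r →
      ‖F p - F p₀ - fderiv ℝ F p₀ (p - p₀)‖ ≤ K * ‖p - p₀‖ ^ 2 := by
  have h1 : ContDiff ℝ 1 (fderiv ℝ F) := hF.fderiv_right (by norm_num)
  obtain ⟨K, s, hs, hK⟩ := h1.contDiffAt.exists_lipschitzOnWith (x := p₀)
  obtain ⟨r, hr, hrs⟩ := Metric.mem_nhds_iff.1 hs
  refine ⟨K, K.2, r, hr, fun p hp => ?_⟩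
  have h2 : ∀ q ∈ Metric.closedBall p₀ ‖p - p₀‖,
      ‖fderiv ℝ F q - fderiv ℝ F p₀‖ ≤ K * ‖p - p₀‖ := by
    intro q hq
    rw [mem_closedBall_iff_norm] at hq
    refine (hK.norm_sub_le (hrs (by simpa [dist_eq_norm] using hq.trans_lt hp))
      (hrs (Metric.mem_ball_self hr))).trans ?_
    gcongr
  have h3 := Convex.norm_image_sub_le_of_norm_fderiv_le' (f := F)
    (fun q _ => (hF.differentiable (by norm_num)) q) h2
    (convex_closedBall _ _) (x := p₀) (y := p) (Metric.mem_closedBall_self (norm_nonneg _))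
    (by simp [dist_eq_norm])
  refine h3.trans (le_of_eq (by ring))

theorem HasDerivAt.comp_exp {x : ℝ → E} {v : E} {s : ℝ}
    (h : HasDerivAt x ((1 / Real.exp s) • v) (Real.exp s)) :
    HasDerivAt (fun s => x (Real.exp s)) v s := by
  refine (h.scomp s (Real.hasDerivAt_exp s)).congr_deriv ?_
  rw [smul_smul, mul_one_div_cancel (Real.exp_ne_zero s), one_smul]

theorem exists_eqOn_Ioc_of_regularSingular [CompleteSpace E] {F : ℝ × E → E} {x₀ : E}
    {D : ℝ × E →L[ℝ] E} {J : E →L[ℝ] E} (hF : HasStrictFDerivAt F D (0, x₀)) (hD : ∀ v, D (0, v) = J v)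
    (hJ : ∀ δ > 0, ∃ C > 0, ∀ τ : ℝ, 0 ≤ τ → ‖NormedSpace.exp (τ • J)‖ ≤ C * Real.exp (δ * τ))
    {ε : ℝ} (hε : 0 < ε) {x y : ℝ → E} {Cx Cy γx γy : ℝ} (hγx : 0 < γx) (hγy : 0 < γy)
    (hx : ∀ t ∈ Ioc 0 ε, HasDerivAt x ((1 / t) • F (t, x t)) t)
    (hy : ∀ t ∈ Ioc 0 ε, HasDerivAt y ((1 / t) • F (t, y t)) t)
    (hx0 : ∀ t ∈ Ioc 0 ε, ‖x t - x₀‖ ≤ Cx * t ^ γx)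
    (hy0 : ∀ t ∈ Ioc 0 ε, ‖y t - x₀‖ ≤ Cy * t ^ γy) :
    ∃ t₁ ∈ Ioc 0 ε, EqOn x y (Ioc 0 t₁) := by
  set γ := min γx γy with hγ
  have hγ0 : 0 < γ := lt_min hγx hγy
  obtain ⟨C, hC, hCJ⟩ := hJ (γ / 2) (by positivity)
  have hB := norm_exp_smul_sub_smul_one_le hCJ γ
  have hc : 0 < γ - γ / 2 := by linarith
  set L := (γ - γ / 2) / (2 * C) with hLdef
  have hL : 0 < L := by positivity
  obtain ⟨r, hr, happ⟩ := hF.exists_norm_sub_sub_le hL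
  have hIoc : ∀ᶠ t : ℝ in 𝓝[>] 0, t ∈ Ioc 0 ε := Ioc_mem_nhdsGT hε
  have hid : Tendsto (fun t : ℝ => t) (𝓝[>] 0) (𝓝 0) := tendsto_nhdsWithin_of_tendsto_nhds tendsto_id
  have hsmall : ∀ {w : ℝ → E} {K κ : ℝ}, 0 < κ → (∀ t ∈ Ioc 0 ε, ‖w t - x₀‖ ≤ K * t ^ κ) →
      ∀ᶠ t : ℝ in 𝓝[>] 0, ‖((t, w t) : ℝ × E) - (0, x₀)‖ < r := by
    intro w K κ hκ hw
    have h1 : Tendsto (fun t : ℝ => K * t ^ κ) (𝓝[>] 0) (𝓝 0) := by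
      have h2 := (hid.rpow_const (p := κ) (Or.inr hκ.le)).const_mul K
      simpa [Real.zero_rpow hκ.ne'] using h2
    filter_upwards [hIoc, h1.eventually_lt_const hr, hid.eventually_lt_const hr] with t ht h3 h4
    rw [Prod.mk_sub_mk, Prod.norm_mk]
    refine max_lt ?_ ((hw t ht).trans_lt h3)
    rwa [sub_zero, Real.norm_eq_abs, abs_of_pos ht.1]
  have hev := (hsmall hγx hx0).and ((hsmall hγy hy0).and
    (hIoc.and (hid.eventually_lt_const one_pos)))
  obtain ⟨t₁, ht₁, hball⟩ := mem_nhdsGT_iff_exists_Ioc_subset.1 hev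
  have ht₁0 : 0 < t₁ := ht₁
  have hmem : ∀ σ ≤ Real.log t₁, Real.exp σ ∈ Ioc 0 t₁ := fun σ hσ =>
    ⟨Real.exp_pos σ, (Real.le_log_iff_exp_le ht₁0).1 hσ⟩
  refine ⟨t₁, (hball ⟨ht₁0, le_rfl⟩).2.2.1, ?_⟩
  have key := eq_zero_of_hasDerivAt_of_norm_exp_smul_le hC hc hB
    (d := fun s => Real.exp (-γ * s) • (y (Real.exp s) - x (Real.exp s)))
    (h := fun s => Real.exp (-γ * s) • (F (Real.exp s, y (Real.exp s))
      - F (Real.exp s, x (Real.exp s)) - J (y (Real.exp s) - x (Real.exp s))))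
    (s₁ := Real.log t₁) (M := |Cy| + |Cx|) hL.le (by rw [hLdef]; field_simp; rfl)
    (fun σ hσ => by
      obtain ⟨_, _, h3, _⟩ := hball (hmem σ hσ)
      have h4 : HasDerivAt (fun s => Real.exp (-γ * s)) (Real.exp (-γ * σ) * -γ) σ := by
        simpa using ((hasDerivAt_id σ).const_mul (-γ)).exp
      refine (h4.smul ((hy _ h3).comp_exp.sub (hx _ h3).comp_exp)).congr_deriv ?_
      simp only [sub_apply, smul_apply, map_smul, one_apply_eq_self, map_sub, Pi.sub_apply]
      module)
    (fun σ hσ => by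
      obtain ⟨_, _, h3, h4⟩ := hball (hmem σ hσ)
      have hbound : ∀ {w : E} {K κ : ℝ}, γ ≤ κ → ‖w‖ ≤ K * Real.exp σ ^ κ →
          Real.exp (-γ * σ) * ‖w‖ ≤ |K| := by
        intro w K κ hκ hw
        have hσ0 : σ ≤ 0 := (Real.exp_lt_one_iff.1 h4).le
        calc _ ≤ Real.exp (-γ * σ) * (|K| * Real.exp (σ * κ)) := by
              rw [Real.exp_mul σ κ]
              gcongr
              exact hw.trans (mul_le_mul_of_nonneg_right (le_abs_self K) (by positivity))
          _ = |K| * Real.exp (-γ * σ + σ * κ) := by rw [Real.exp_add]; ring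
          _ ≤ |K| * 1 := by
              gcongr
              rw [Real.exp_le_one_iff]
              nlinarith
          _ = |K| := mul_one _
      rw [norm_smul, Real.norm_eq_abs, Real.abs_exp]
      calc _ = Real.exp (-γ * σ) *
              ‖(y (Real.exp σ) - x₀) - (x (Real.exp σ) - x₀)‖ := by rw [sub_sub_sub_cancel_right]
        _ ≤ Real.exp (-γ * σ) * (‖y (Real.exp σ) - x₀‖ + ‖x (Real.exp σ) - x₀‖) := by
            gcongr
            exact norm_sub_le _ _
        _ ≤ _ := by
            rw [mul_add]
            exact add_le_add (hbound (min_le_right _ _) (hy0 _ h3))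
              (hbound (min_le_left _ _) (hx0 _ h3)))
    (fun σ hσ => by
      obtain ⟨h1, h2, _, _⟩ := hball (hmem σ hσ)
      have h3 := happ _ _ h2 h1
      rw [Prod.mk_sub_mk, sub_self, hD, Prod.norm_mk, norm_zero,
        max_eq_right (norm_nonneg _)] at h3
      rw [norm_smul, norm_smul, mul_left_comm]
      gcongr)
  intro t ht
  have h1 := key (Real.log t) (Real.log_le_log ht.1 ht.2)
  simp only [Real.exp_log ht.1] at h1
  rw [smul_eq_zero_iff_right (Real.exp_ne_zero _), sub_eq_zero] at h1
  exact h1.symm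

theorem eqOn_Icc_of_regularSingular [FiniteDimensional ℝ E] {F : ℝ × E → E}
    (hF : ContDiff ℝ 1 F) {t₁ ε : ℝ} (ht₁ : 0 < t₁) {x y : ℝ → E}
    (hx : ∀ t ∈ Icc t₁ ε, HasDerivAt x ((1 / t) • F (t, x t)) t)
    (hy : ∀ t ∈ Icc t₁ ε, HasDerivAt y ((1 / t) • F (t, y t)) t) (h : x t₁ = y t₁) :
    EqOn x y (Icc t₁ ε) := by
  have hxc : ContinuousOn x (Icc t₁ ε) := fun t ht => (hx t ht).continuousAt.continuousWithinAt
  have hyc : ContinuousOn y (Icc t₁ ε) := fun t ht => (hy t ht).continuousAt.continuousWithinAt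
  obtain ⟨Rx, hRx⟩ := isCompact_Icc.exists_bound_of_continuousOn hxc
  obtain ⟨Ry, hRy⟩ := isCompact_Icc.exists_bound_of_continuousOn hyc
  set R := max Rx Ry
  have hG : ContDiffOn ℝ 1 (fun p : ℝ × E => (1 / p.1) • F p)
      (Icc t₁ ε ×ˢ Metric.closedBall 0 R) := by
    refine ContDiffOn.smul (contDiffOn_const.div contDiffOn_fst fun p hp => ?_) hF.contDiffOn
    exact (ht₁.trans_le hp.1.1).ne'
  obtain ⟨K, hK⟩ := hG.exists_lipschitzOnWith one_ne_zero
    ((convex_Icc _ _).prod (convex_closedBall _ _))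
    (isCompact_Icc.prod (isCompact_closedBall _ _))
  refine ODE_solution_unique_of_mem_Icc_right (v := fun t v => (1 / t) • F (t, v))
    (s := fun _ => Metric.closedBall 0 R) (K := K) (fun t ht => ?_) hxc
    (fun t ht => (hx t (Ico_subset_Icc_self ht)).hasDerivWithinAt) (fun t ht => ?_) hyc
    (fun t ht => (hy t (Ico_subset_Icc_self ht)).hasDerivWithinAt) (fun t ht => ?_) h
  · refine LipschitzOnWith.of_dist_le_mul fun v hv w hw => ?_
    have := hK.dist_le_mul (t, v) ⟨Ico_subset_Icc_self ht, hv⟩ (t, w)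
      ⟨Ico_subset_Icc_self ht, hw⟩
    simpa [Prod.dist_eq] using this
  · exact mem_closedBall_zero_iff.2 ((hRx t (Ico_subset_Icc_self ht)).trans (le_max_left _ _))
  · exact mem_closedBall_zero_iff.2 ((hRy t (Ico_subset_Icc_self ht)).trans (le_max_right _ _))

end RegularSingular

theorem exists_bounded_log_solution {n : ℕ} {F : ℝ × (Fin n → ℝ) → Fin n → ℝ} {x₀ : Fin n → ℝ}
    {D : ℝ × (Fin n → ℝ) →L[ℝ] (Fin n → ℝ)} {J : (Fin n → ℝ) →L[ℝ] (Fin n → ℝ)}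
    (hFc : Continuous F) (hF : HasStrictFDerivAt F D (0, x₀)) (hF0 : F (0, x₀) = 0)
    (hD : ∀ v, D (0, v) = J v)
    (hJ : ∀ δ > 0, ∃ C > 0, ∀ τ : ℝ, 0 ≤ τ → ‖NormedSpace.exp (τ • J)‖ ≤ C * Real.exp (δ * τ)) :
    ∃ (s₀ R R' : ℝ) (z : ℝ → Fin n → ℝ), 1 ≤ R ∧ (∀ s, ‖z s‖ ≤ R) ∧ ∀ s ≤ s₀,
      ‖Real.exp (-s) • F (Real.exp s, x₀ + Real.exp s • z s)‖ ≤ R' ∧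
      HasDerivAt z (-z s + Real.exp (-s) • F (Real.exp s, x₀ + Real.exp s • z s)) s := by
  obtain ⟨C, hC, hCJ⟩ := hJ (1 / 2) (by positivity)
  have hB := norm_exp_smul_sub_smul_one_le hCJ 1
  have hc : (0 : ℝ) < 1 - 1 / 2 := by norm_num
  set a := D (1, 0)
  set R := 4 * C * ‖a‖ + 1 with hRdef
  have hR1 : 1 ≤ R := by simp only [R]; linarith [mul_nonneg hC.le (norm_nonneg a)]
  set L := 1 / (4 * C) with hLdef
  have hL : 0 < L := by positivity
  obtain ⟨r, hr, happ⟩ := hF.exists_norm_sub_sub_le hL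
  have hDt : ∀ t v, D (t, v) = t • a + J v := by
    intro t v
    rw [← hD, ← map_smul, ← map_add]
    simp
  set s₀ := Real.log (r / (2 * R)) with hs₀
  have hexp0 : Real.exp s₀ = r / (2 * R) := Real.exp_log (by positivity)
  set cl : (Fin n → ℝ) → Fin n → ℝ := fun z i => max (-R) (min R (z i))
  have hclc : Continuous cl := by fun_prop
  have hclR : ∀ z, ‖cl z‖ ≤ R := by
    intro z
    refine (pi_norm_le_iff_of_nonneg (by linarith)).2 fun i => ?_
    rw [Real.norm_eq_abs, abs_le]
    exact ⟨le_max_left _ _, max_le (by linarith) (min_le_left _ _)⟩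
  have hcllip : ∀ z w, ‖cl z - cl w‖ ≤ ‖z - w‖ := by
    intro z w
    refine (pi_norm_le_iff_of_nonneg (norm_nonneg _)).2 fun i => ?_
    refine le_trans ?_ (norm_le_pi_norm (z - w) i)
    simp only [cl, Pi.sub_apply, Real.norm_eq_abs]
    refine (abs_max_sub_max_le_max _ _ _ _).trans ?_
    rw [sub_self, abs_zero, max_eq_right (abs_nonneg _)]
    refine (abs_min_sub_min_le_max _ _ _ _).trans ?_
    rw [sub_self, abs_zero, max_eq_right (abs_nonneg _)]
  have hcleq : ∀ z, ‖z‖ ≤ R → cl z = z := by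
    intro z hz
    funext i
    have := (abs_le.1 ((norm_le_pi_norm z i).trans hz))
    simp only [cl]
    rw [min_eq_right this.2, max_eq_right this.1]
  set G : ℝ → (Fin n → ℝ) → Fin n → ℝ :=
    fun t v => F (t, x₀ + t • v) - t • J v with hG
  have hnear : ∀ t, 0 < t → t ≤ Real.exp s₀ → ∀ v, ‖v‖ ≤ R →
      ‖((t, x₀ + t • v) : ℝ × (Fin n → ℝ)) - (0, x₀)‖ < r ∧
      ‖((t, x₀ + t • v) : ℝ × (Fin n → ℝ)) - (0, x₀)‖ ≤ t * R := by
    intro t ht hts v hv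
    have h2 : ‖((t, x₀ + t • v) : ℝ × (Fin n → ℝ)) - (0, x₀)‖ ≤ t * R := by
      rw [Prod.mk_sub_mk, Prod.norm_mk, add_sub_cancel_left, sub_zero, norm_smul,
        Real.norm_eq_abs, abs_of_pos ht]
      exact max_le (by nlinarith) (by gcongr)
    refine ⟨h2.trans_lt ?_, h2⟩
    calc t * R ≤ r / (2 * R) * R := by gcongr; exact hts.trans hexp0.le
      _ = r / 2 := by field_simp
      _ < r := by linarith
  have hGlip : ∀ t, 0 < t → t ≤ Real.exp s₀ → ∀ v w, ‖v‖ ≤ R → ‖w‖ ≤ R →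
      ‖G t v - G t w‖ ≤ t * (L * ‖v - w‖) := by
    intro t ht hts v w hv hw
    have h1 := happ _ _ (hnear t ht hts v hv).1 (hnear t ht hts w hw).1
    have h2 : ((t, x₀ + t • v) : ℝ × (Fin n → ℝ)) - (t, x₀ + t • w) = (0, t • (v - w)) := by
      ext1 <;> simp [smul_sub]
    rw [h2, hD, Prod.norm_mk, norm_zero, max_eq_right (norm_nonneg _), norm_smul,
      Real.norm_eq_abs, abs_of_pos ht] at h1
    refine (le_of_eq ?_).trans (h1.trans (le_of_eq (by ring)))
    congr 1
    simp only [hG, map_smul, map_sub, smul_sub]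
    abel
  have hGbd : ∀ t, 0 < t → t ≤ Real.exp s₀ → ∀ v, ‖v‖ ≤ R →
      ‖G t v‖ ≤ t * (L * R + ‖a‖) := by
    intro t ht hts v hv
    obtain ⟨h1, h2⟩ := hnear t ht hts v hv
    have h3 := happ _ (0, x₀) h1 (by simpa using hr)
    rw [Prod.mk_sub_mk, add_sub_cancel_left, sub_zero, hDt, hF0, sub_zero] at h3
    have h4 : G t v = (F (t, x₀ + t • v) - (t • a + J (t • v))) + t • a := by
      simp only [hG, map_smul]
      abel
    rw [h4]
    refine (norm_add_le _ _).trans ?_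
    rw [norm_smul, Real.norm_eq_abs, abs_of_pos ht, mul_add]
    gcongr
    refine h3.trans ?_
    rw [Prod.mk_sub_mk, add_sub_cancel_left, sub_zero] at h2
    calc _ ≤ L * (t * R) := by gcongr
      _ = _ := by ring
  set g : ℝ → (Fin n → ℝ) → Fin n → ℝ :=
    fun s z => Real.exp (-min s s₀) • G (Real.exp (min s s₀)) (cl z) with hg
  have hexple : ∀ s, Real.exp (min s s₀) ≤ Real.exp s₀ := fun s =>
    Real.exp_le_exp.2 (min_le_right _ _)
  have hcancel : ∀ s b : ℝ, Real.exp (-s) * (Real.exp s * b) = b := by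
    intro s b
    rw [← mul_assoc, ← Real.exp_add]
    simp
  obtain ⟨z, hz⟩ := exists_hasDerivAt_bounded_of_lipschitz hC hc hB (g := g)
    (by simp only [hg, hG]; fun_prop) (H := L * R + ‖a‖) (L := L) hL.le
    (fun s z => by
      simp only [hg]
      rw [norm_smul, Real.norm_eq_abs, Real.abs_exp, ← hcancel (min s s₀) (L * R + ‖a‖)]
      gcongr
      exact hGbd _ (Real.exp_pos _) (hexple s) _ (hclR z))
    (fun s z w => by
      simp only [hg]
      rw [← smul_sub, norm_smul, Real.norm_eq_abs, Real.abs_exp,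
        ← hcancel (min s s₀) (L * ‖z - w‖)]
      gcongr
      refine (hGlip _ (Real.exp_pos _) (hexple s) _ _ (hclR z) (hclR w)).trans ?_
      gcongr
      exact hcllip z w)
    (by rw [hLdef]; apply le_of_eq; field_simp; norm_num)
  have hzR : ∀ s, ‖z s‖ ≤ R := by
    intro s
    refine (hz s).2.trans ?_
    have : C * (L * R + ‖a‖) / (1 - 1 / 2) = R / 2 + 2 * C * ‖a‖ := by
      rw [hLdef]
      field_simp
      ring
    rw [this]
    linarith
  have hgz : ∀ s ≤ s₀, g s (z s)
      = Real.exp (-s) • F (Real.exp s, x₀ + Real.exp s • z s) - J (z s) := by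
    intro s hs
    simp only [hg, hG, min_eq_left hs, hcleq _ (hzR s), smul_sub]
    rw [smul_smul, ← Real.exp_add]
    simp
  refine ⟨s₀, R, (L * R + ‖a‖) + ‖J‖ * R, z, hR1, hzR, fun s hs => ⟨?_, ?_⟩⟩
  · rw [eq_add_of_sub_eq (hgz s hs).symm]
    refine (norm_add_le _ _).trans (add_le_add ?_ (J.le_of_opNorm_le_of_le le_rfl (hzR s)))
    simp only [hg]
    rw [norm_smul, Real.norm_eq_abs, Real.abs_exp, ← hcancel (min s s₀) (L * R + ‖a‖)]
    gcongr
    exact hGbd _ (Real.exp_pos _) (hexple s) _ (hclR _)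
  · refine (hz s).1.congr_deriv ?_
    rw [hgz s hs]
    simp only [sub_apply, one_smul, one_apply_eq_self]
    abel

theorem exists_norm_log_solution_le_exp {E : Type*} [NormedAddCommGroup E] [NormedSpace ℝ E]
    [CompleteSpace E] {F : ℝ × E → E} {x₀ : E} {J : E →L[ℝ] E}
    (hF : ContDiff ℝ 2 F) (hF0 : F (0, x₀) = 0)
    (hD : ∀ t v, fderiv ℝ F (0, x₀) (t, v) = J v)
    (hJ : ∀ δ > 0, ∃ C > 0, ∀ τ : ℝ, 0 ≤ τ → ‖NormedSpace.exp (τ • J)‖ ≤ C * Real.exp (δ * τ))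
    {s₀ R : ℝ} {z : ℝ → E} (hR1 : 1 ≤ R) (hzR : ∀ s, ‖z s‖ ≤ R)
    (hz : ∀ s ≤ s₀, HasDerivAt z
      (-z s + Real.exp (-s) • F (Real.exp s, x₀ + Real.exp s • z s)) s) :
    ∃ M s₁ : ℝ, ∀ s ≤ s₁, ‖z s‖ ≤ M * Real.exp s := by
  obtain ⟨C, hC, hCJ⟩ := hJ (1 / 2) (by positivity)
  have hB := norm_exp_smul_sub_smul_one_le hCJ 1
  obtain ⟨K, hK, r, hr, hquad⟩ := hF.exists_norm_sub_sub_fderiv_le_sq (0, x₀)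
  have hexp0 : Real.exp (Real.log (r / (2 * R))) = r / (2 * R) := Real.exp_log (by positivity)
  refine ⟨C * (K * R ^ 2) / (1 - 1 / 2), min s₀ (Real.log (r / (2 * R))), fun s hs => ?_⟩
  have := norm_le_of_hasDerivAt_of_norm_exp_smul_le hC (by norm_num) hB (d := z) (s := s)
    (h := fun s => Real.exp (-s) • F (Real.exp s, x₀ + Real.exp s • z s) - J (z s))
    (M := R) (H := K * R ^ 2) (b := 1) zero_le_one (by positivity)
    (fun σ hσ => by
      refine (hz σ (hσ.trans (hs.trans (min_le_left _ _)))).congr_deriv ?_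
      simp only [sub_apply, one_smul, one_apply_eq_self]
      abel)
    (fun σ _ => hzR σ)
    (fun σ hσ => by
      have h0 : Real.exp σ ≤ r / (2 * R) := by
        rw [← hexp0]
        exact Real.exp_le_exp.2 (hσ.trans (hs.trans (min_le_right _ _)))
      have h2 : ‖((Real.exp σ, x₀ + Real.exp σ • z σ) : ℝ × E) - (0, x₀)‖ ≤ Real.exp σ * R := by
        rw [Prod.mk_sub_mk, Prod.norm_mk, add_sub_cancel_left, sub_zero, norm_smul,
          Real.norm_eq_abs, Real.abs_exp]
        refine max_le (by nlinarith [Real.exp_pos σ]) ?_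
        gcongr
        exact hzR σ
      have h3 := hquad _ (h2.trans_lt (by
        calc Real.exp σ * R ≤ r / (2 * R) * R := by gcongr
          _ = r / 2 := by field_simp
          _ < r := by linarith))
      have h4 : K * ‖((Real.exp σ, x₀ + Real.exp σ • z σ) : ℝ × E) - (0, x₀)‖ ^ 2
          ≤ K * (Real.exp σ * R) ^ 2 := by gcongr
      replace h3 := h3.trans h4
      rw [Prod.mk_sub_mk, add_sub_cancel_left, sub_zero, hF0, sub_zero, hD] at h3
      have hcancel : Real.exp (-σ) * Real.exp σ = 1 := by
        rw [← Real.exp_add]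
        simp
      have h5 : Real.exp (-σ) • F (Real.exp σ, x₀ + Real.exp σ • z σ) - J (z σ)
          = Real.exp (-σ) • (F (Real.exp σ, x₀ + Real.exp σ • z σ) - J (Real.exp σ • z σ)) := by
        rw [smul_sub, map_smul, smul_smul, hcancel, one_smul]
      rw [h5, norm_smul, Real.norm_eq_abs, Real.abs_exp, one_mul]
      calc _ ≤ Real.exp (-σ) * (K * (Real.exp σ * R) ^ 2) := by gcongr
        _ = (Real.exp (-σ) * Real.exp σ) * (K * R ^ 2 * Real.exp σ) := by ring
        _ = _ := by rw [hcancel, one_mul])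
  rwa [one_mul] at this

/-- Uniqueness at a regular singular point: if `F ∈ C²`, `F(0,x₀) = 0` and the Jacobian
`J = F_x(0,x₀)` has no eigenvalue with positive real part, then the system `x' = F(t,x)/t`
has a unique solution on `(0,ε]` which is Hölder continuous on `[0,ε]` with `x(0) = x₀`;
if moreover `F_t(0,x₀) = 0` then `x(t) - x₀ = O(t²)` as `t → 0⁺`. -/
theorem stmt17 (n : ℕ) (F : ℝ × (Fin n → ℝ) → Fin n → ℝ)
    (hF : ContDiff ℝ 2 F) (x₀ : Fin n → ℝ)
    (hF0 : F (0, x₀) = 0)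
    (J : Matrix (Fin n) (Fin n) ℝ)
    (hJ : HasFDerivAt (fun x => F (0, x))
      (LinearMap.toContinuousLinearMap (Matrix.toLin' J)) x₀)
    (hspec : ∀ z ∈ spectrum ℂ (J.map (fun r => (r : ℂ))), z.re ≤ 0) :
    ∃ ε > (0:ℝ), ∃ x : ℝ → Fin n → ℝ,
      ((∀ t ∈ Set.Ioc (0:ℝ) ε, HasDerivAt x ((1/t) • F (t, x t)) t) ∧
        x 0 = x₀ ∧
        ∃ C γ : NNReal, 0 < γ ∧ HolderOnWith C γ x (Set.Icc 0 ε)) ∧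
      (∀ y : ℝ → Fin n → ℝ,
        ((∀ t ∈ Set.Ioc (0:ℝ) ε, HasDerivAt y ((1/t) • F (t, y t)) t) ∧
          y 0 = x₀ ∧
          ∃ C γ : NNReal, 0 < γ ∧ HolderOnWith C γ y (Set.Icc 0 ε)) →
        Set.EqOn x y (Set.Icc 0 ε)) ∧
      (deriv (fun t : ℝ => F (t, x₀)) 0 = 0 →
        (fun t => x t - x₀) =O[nhdsWithin 0 (Set.Ioi (0:ℝ))] fun t => t ^ 2) := by
  set A := LinearMap.toContinuousLinearMap (Matrix.toLin' J)
  have hA : ∀ δ > 0, ∃ C > 0, ∀ τ : ℝ, 0 ≤ τ →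
      ‖NormedSpace.exp (τ • A)‖ ≤ C * Real.exp (δ * τ) :=
    fun δ hδ => Matrix.exists_norm_exp_smul_toLin'_le J hspec hδ
  have hstrict : HasStrictFDerivAt F (fderiv ℝ F (0, x₀)) (0, x₀) :=
    hF.contDiffAt.hasStrictFDerivAt (by norm_num)
  have hD : ∀ v, fderiv ℝ F (0, x₀) (0, v) = A v := by
    intro v
    have h1 : HasFDerivAt (fun x => F (0, x))
        ((fderiv ℝ F (0, x₀)).comp (ContinuousLinearMap.inr ℝ ℝ (Fin n → ℝ))) x₀ :=
      hstrict.hasFDerivAt.comp x₀ (hasFDerivAt_prodMk_right (0 : ℝ) x₀)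
    rw [hJ.unique h1]
    simp
  obtain ⟨s₀, R, R', z, hR1, hzR, hz⟩ :=
    exists_bounded_log_solution hF.continuous hstrict hF0 hD hA
  set x : ℝ → Fin n → ℝ := fun t => x₀ + t • z (Real.log t) with hxdef
  have hlog : ∀ t ∈ Ioc 0 (Real.exp s₀), Real.log t ≤ s₀ := fun t ht =>
    (Real.log_le_iff_le_exp ht.1).2 ht.2
  have hx : ∀ t ∈ Ioc 0 (Real.exp s₀), HasDerivAt x ((1 / t) • F (t, x t)) t := by
    intro t ht
    have h1 := (hz _ (hlog t ht)).2
    rw [Real.exp_neg, Real.exp_log ht.1] at h1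
    have h2 := h1.scomp t (Real.hasDerivAt_log ht.1.ne')
    refine (((hasDerivAt_id t).smul h2).const_add x₀).congr_deriv ?_
    simp only [id, Function.comp, one_smul]
    rw [smul_smul, mul_inv_cancel₀ ht.1.ne', one_smul, one_div]
    simp [hxdef]
  have hxdist : ∀ t, ‖x t - x₀‖ ≤ R * |t| := by
    intro t
    simp only [hxdef, add_sub_cancel_left, norm_smul, Real.norm_eq_abs]
    rw [mul_comm]
    gcongr
    exact hzR _
  have hx0 : x 0 = x₀ := by simp [hxdef]
  have hxlip : LipschitzOnWith R'.toNNReal x (Icc 0 (Real.exp s₀)) := by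
    rw [← closure_Ioc (Real.exp_pos s₀).ne]
    refine LipschitzOnWith.closure ?_ ?_
    · rw [closure_Ioc (Real.exp_pos s₀).ne]
      intro t ht
      rcases ht.1.eq_or_lt with rfl | h
      · refine ContinuousAt.continuousWithinAt ?_
        rw [ContinuousAt, hx0, tendsto_iff_norm_sub_tendsto_zero]
        refine squeeze_zero (fun _ => norm_nonneg _) hxdist ?_
        simpa using (continuous_abs.tendsto (0 : ℝ)).const_mul R
      · exact (hx t ⟨h, ht.2⟩).continuousAt.continuousWithinAt
    · refine Convex.lipschitzOnWith_of_nnnorm_hasDerivWithin_le (convex_Ioc _ _)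
        (fun t ht => (hx t ht).hasDerivWithinAt) fun t ht => ?_
      have h1 := (hz _ (hlog t ht)).1
      rw [Real.exp_neg, Real.exp_log ht.1, ← one_div] at h1
      exact NNReal.le_toNNReal_of_coe_le h1
  refine ⟨Real.exp s₀, Real.exp_pos s₀, x, ⟨hx, hx0, R'.toNNReal, 1, one_pos,
    hxlip.holderOnWith⟩, ?_, ?_⟩
  · rintro y ⟨hy, hy0, Cy, γ, hγ, hyh⟩
    have hydist : ∀ t ∈ Ioc 0 (Real.exp s₀), ‖y t - x₀‖ ≤ Cy * t ^ (γ : ℝ) := by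
      intro t ht
      have := hyh.dist_le (Ioc_subset_Icc_self ht) (left_mem_Icc.2 (Real.exp_pos s₀).le)
      rwa [hy0, dist_eq_norm, Real.dist_eq, sub_zero, abs_of_pos ht.1] at this
    obtain ⟨t₁, ht₁, heq⟩ := exists_eqOn_Ioc_of_regularSingular hstrict hD hA (Real.exp_pos s₀)
      (γx := 1) (Cx := R) one_pos hγ hx hy
      (fun t ht => by
        have := hxdist t
        rw [Real.rpow_one]
        rwa [abs_of_pos ht.1] at this) hydist
    have heq' := eqOn_Icc_of_regularSingular (hF.of_le (by norm_num)) ht₁.1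
      (fun t ht => hx t ⟨ht₁.1.trans_le ht.1, ht.2⟩) (fun t ht => hy t ⟨ht₁.1.trans_le ht.1, ht.2⟩)
      (heq ⟨ht₁.1, le_rfl⟩)
    intro t ht
    rcases ht.1.eq_or_lt with rfl | h
    · rw [hx0, hy0]
    · rcases le_total t t₁ with h1 | h1
      · exact heq ⟨h, h1⟩
      · exact heq' ⟨h1, ht.2⟩
  · intro hderiv
    have hD' : ∀ t v, fderiv ℝ F (0, x₀) (t, v) = A v := by
      have h1 : HasDerivAt (fun t : ℝ => F (t, x₀)) (fderiv ℝ F (0, x₀) (1, 0)) 0 :=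
        hstrict.hasFDerivAt.comp_hasDerivAt (0 : ℝ)
          ((hasDerivAt_id (0 : ℝ)).prodMk (hasDerivAt_const (0 : ℝ) x₀))
      have h2 := h1.deriv.symm.trans hderiv
      intro t v
      have h3 : ((t, v) : ℝ × (Fin n → ℝ)) = t • (1, 0) + (0, v) := by simp
      rw [h3, map_add, map_smul, h2, smul_zero, zero_add, hD]
    obtain ⟨M, s₁, hM⟩ := exists_norm_log_solution_le_exp hF hF0 hD' hA hR1 hzR
      (fun s hs => (hz s hs).2)
    refine IsBigO.of_bound M ?_
    filter_upwards [Ioc_mem_nhdsGT (Real.exp_pos s₁)] with t ht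
    have h1 := hM (Real.log t) ((Real.log_le_iff_le_exp ht.1).2 ht.2)
    rw [Real.exp_log ht.1] at h1
    simp only [hxdef, add_sub_cancel_left, norm_smul, Real.norm_eq_abs, abs_pow,
      abs_of_pos ht.1]
    calc t * ‖z (Real.log t)‖ ≤ t * (M * t) := by
          have := ht.1
          gcongr
      _ = M * t ^ 2 := by ring
end
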